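/- Let N ≥ 2 and let Ω ⊆ ℝ^N be an open set. Then the Moser–Trudinger inequality holds for Ω, i.e. sup { ∫_Ω Φ(u(x)) dx : u ∈ C_c^∞(Ω), ∫_Ω |∇u(x)|^N dx ≤ 1 } < +∞, if and only if the Poincaré inequality holds for Ω, i.e. λ₁(Ω) := inf { ∫_Ω |∇u(x)|^N dx / ∫_Ω |u(x)|^N dx : u ∈ C_c^∞(Ω), u ≢ 0 } > 0. -/

import Mathlib

open MeasureTheory Real

/-- `ω_{N-1}`, the `(N-1)`-dimensional measure of the unit sphere in `ℝ^N`. -/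
noncomputable def sphereVol (N : ℕ) : ℝ :=
  N * Real.pi ^ ((N : ℝ) / 2) / Real.Gamma ((N : ℝ) / 2 + 1)

/-- `α_N := N ω_{N-1}^{1/(N-1)}`. -/
noncomputable def alphaMT (N : ℕ) : ℝ := N * sphereVol N ^ ((1 : ℝ) / ((N : ℝ) - 1))

/-- `Φ(t) := e^{α_N |t|^{N/(N-1)}} - ∑_{j=0}^{N-2} α_N^j |t|^{jN/(N-1)} / j!`. -/
noncomputable def PhiMT (N : ℕ) (t : ℝ) : ℝ :=
  Real.exp (alphaMT N * |t| ^ ((N : ℝ) / ((N : ℝ) - 1))) -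
    ∑ j ∈ Finset.range (N - 1),
      alphaMT N ^ j * |t| ^ ((j : ℝ) * N / ((N : ℝ) - 1)) / (Nat.factorial j : ℝ)

/-- `u ∈ C_c^∞(Ω)`: smooth, compactly supported, with support contained in `Ω`. -/
def IsTest {N : ℕ} (Ω : Set (EuclideanSpace ℝ (Fin N)))
    (u : EuclideanSpace ℝ (Fin N) → ℝ) : Prop :=
  ContDiff ℝ (⊤ : ℕ∞) u ∧ HasCompactSupport u ∧ tsupport u ⊆ Ω

section MTPaux

open scoped ENNReal
open Set

namespace MTP

/-- One-dimensional crossing lemma. -/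
lemma ray_crossing (g g' : ℝ → ℝ) (hg : ∀ r, HasDerivAt g (g' r) r) (hg' : Continuous g')
    {s t : ℝ} (hst : s < t) (h0 : t ≤ g 0) (hr : ∃ r, 0 ≤ r ∧ g r ≤ s) :
    ENNReal.ofReal (t - s) ≤
      ∫⁻ r in Ioi (0:ℝ), {r | s < g r ∧ g r < t}.indicator (fun r => ‖g' r‖ₑ) r := by
  have hgc : Continuous g := continuous_iff_continuousAt.2 fun r => (hg r).continuousAt
  obtain ⟨r0, hr0, hgr0⟩ := hr
  set S : Set ℝ := {r | 0 ≤ r ∧ g r ≤ s} with hS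
  have hSc : IsClosed S :=
    (isClosed_le continuous_const continuous_id).inter (isClosed_le hgc continuous_const)
  have hSne : S.Nonempty := ⟨r0, hr0, hgr0⟩
  have hSb : BddBelow S := ⟨0, fun r hr => hr.1⟩
  set b := sInf S with hb
  have hbS : b ∈ S := hSc.csInf_mem hSne hSb
  have hbelow : ∀ r, 0 ≤ r → r < b → s < g r := by
    intro r h1 h2
    by_contra h
    exact absurd (csInf_le hSb (show r ∈ S from ⟨h1, not_lt.1 h⟩)) (not_le.2 h2)
  set T : Set ℝ := Icc 0 b ∩ {r | t ≤ g r} with hT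
  have hTc : IsCompact T := isCompact_Icc.inter_right (isClosed_le continuous_const hgc)
  have hTne : T.Nonempty := ⟨0, ⟨le_refl _, hbS.1⟩, h0⟩
  set a := sSup T with ha
  have haT : a ∈ T := hTc.sSup_mem hTne
  have hab : a < b := by
    rcases haT.1.2.lt_or_eq with h | h
    · exact h
    · exfalso
      have h1 := haT.2
      have h2 := hbS.2
      simp only [mem_ofPred_eq] at h1
      rw [h] at h1
      linarith
  have hmid : ∀ r ∈ Ioo a b, s < g r ∧ g r < t := by
    intro r hr
    refine ⟨hbelow r (haT.1.1.trans hr.1.le) hr.2, ?_⟩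
    by_contra h
    have : r ∈ T := ⟨⟨haT.1.1.trans hr.1.le, hr.2.le⟩, not_lt.1 h⟩
    exact absurd (le_csSup hTc.bddAbove this) (not_le.2 hr.1)
  have hintg : ∫ r in a..b, g' r = g b - g a :=
    intervalIntegral.integral_eq_sub_of_hasDerivAt (fun r _ => hg r) (hg'.intervalIntegrable _ _)
  have h1 : t - s ≤ ‖∫ r in a..b, g' r‖ := by
    rw [hintg, Real.norm_eq_abs, abs_sub_comm]
    have h1 := haT.2
    have h2 := hbS.2
    simp only [mem_ofPred_eq] at h1
    exact le_trans (by linarith) (le_abs_self _)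
  calc ENNReal.ofReal (t - s) ≤ ENNReal.ofReal ‖∫ r in a..b, g' r‖ := ENNReal.ofReal_le_ofReal h1
    _ = ‖∫ r in Ioc a b, g' r‖ₑ := by
        rw [intervalIntegral.integral_of_le hab.le, ofReal_norm]
    _ = ‖∫ r in Ioo a b, g' r‖ₑ := by rw [integral_Ioc_eq_integral_Ioo]
    _ ≤ ∫⁻ r in Ioo a b, ‖g' r‖ₑ := enorm_integral_le_lintegral_enorm _
    _ = ∫⁻ r in Ioo a b, {r | s < g r ∧ g r < t}.indicator (fun r => ‖g' r‖ₑ) r := by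
        refine setLIntegral_congr_fun measurableSet_Ioo ?_
        intro r hr
        simp only
        rw [indicator_of_mem (show r ∈ {r | s < g r ∧ g r < t} from hmid r hr)]
    _ ≤ _ := lintegral_mono_set fun r hr => lt_of_le_of_lt haT.1.1 hr.1

variable {N : ℕ}

lemma ray_test {u : EuclideanSpace ℝ (Fin N) → ℝ} (hu : ContDiff ℝ 1 u) (hc : HasCompactSupport u)
    {s t : ℝ} (hs : 0 ≤ s) (hst : s < t) (x z : EuclideanSpace ℝ (Fin N)) (hz : z ≠ 0)
    (hx : t ≤ |u x|) :
    ENNReal.ofReal (t - s) ≤ ∫⁻ r in Ioi (0:ℝ),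
      {y | s < |u y| ∧ |u y| < t}.indicator (fun y => ‖fderiv ℝ u y‖ₑ) (x + r • z) * ‖z‖ₑ := by
  -- reduce to positive value
  wlog hpos : 0 ≤ u x generalizing u with H
  · have := H (u := fun y => - u y) hu.neg (show HasCompactSupport (-u) from hc.neg) (by simpa using hx)
      (by linarith)
    have hf : ∀ y, fderiv ℝ (fun y => - u y) y = - fderiv ℝ u y := fun y => fderiv_fun_neg
    simpa [hf] using this
  rw [abs_of_nonneg hpos] at hx
  have hd : Differentiable ℝ u := hu.differentiable (by norm_num)
  have hray : ∀ r : ℝ, HasDerivAt (fun r : ℝ => u (x + r • z)) (fderiv ℝ u (x + r • z) z) r := by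
    intro r
    have h1 : HasDerivAt (fun r : ℝ => x + r • z) z r := by
      simpa using ((hasDerivAt_id r).smul_const z).const_add x
    exact (hd _).hasFDerivAt.comp_hasDerivAt r h1
  have hcont : Continuous (fun r : ℝ => fderiv ℝ u (x + r • z) z) := by
    have := hu.continuous_fderiv (by norm_num)
    exact (this.comp (by fun_prop)).clm_apply continuous_const
  have hex : ∃ r : ℝ, 0 ≤ r ∧ u (x + r • z) ≤ s := by
    obtain ⟨M, hM⟩ := hc.isCompact.isBounded.exists_norm_le
    have hzn : 0 < ‖z‖ := norm_pos_iff.2 hz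
    refine ⟨(|M| + ‖x‖ + 1) / ‖z‖, by positivity, ?_⟩
    suffices hmem : x + ((|M| + ‖x‖ + 1) / ‖z‖) • z ∉ tsupport u by
      rw [image_eq_zero_of_notMem_tsupport hmem]; exact hs
    · intro hmem
      have h1 := hM _ hmem
      have h2 : ‖((|M| + ‖x‖ + 1) / ‖z‖) • z‖ = |M| + ‖x‖ + 1 := by
        rw [norm_smul, Real.norm_eq_abs, abs_of_nonneg (by positivity)]
        field_simp
      have h3 : ‖((|M| + ‖x‖ + 1) / ‖z‖) • z‖ ≤ ‖x + ((|M| + ‖x‖ + 1) / ‖z‖) • z‖ + ‖x‖ := by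
        have := norm_sub_le (x + ((|M| + ‖x‖ + 1) / ‖z‖) • z) x
        simpa using this
      have := le_abs_self M
      linarith
  refine (ray_crossing _ _ hray hcont hst (by simpa using hx) hex).trans ?_
  refine lintegral_mono fun r => ?_
  by_cases h : s < u (x + r • z) ∧ u (x + r • z) < t
  · have h' : s < |u (x + r • z)| ∧ |u (x + r • z)| < t := by
      rw [abs_of_nonneg (hs.trans h.1.le)]; exact h
    rw [indicator_of_mem (show r ∈ {r : ℝ | s < u (x + r • z) ∧ u (x + r • z) < t} from h),
      indicator_of_mem (show x + r • z ∈ {y | s < |u y| ∧ |u y| < t} from h')]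
    exact ContinuousLinearMap.le_opENorm _ _
  · rw [indicator_of_notMem (show r ∉ {r : ℝ | s < u (x + r • z) ∧ u (x + r • z) < t} from h)]
    exact zero_le

/-- scaling of Lebesgue integrals -/
lemma lintegral_scale (f : EuclideanSpace ℝ (Fin N) → ℝ≥0∞) (hf : Measurable f) {r : ℝ}
    (hr : 0 < r) :
    ∫⁻ z, f (r • z) = ENNReal.ofReal ((r ^ N)⁻¹) * ∫⁻ z, f z := by
  have h := Measure.map_addHaar_smul (volume : Measure (EuclideanSpace ℝ (Fin N))) hr.ne'
  rw [finrank_euclideanSpace, Fintype.card_fin, abs_of_pos (by positivity)] at h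
  rw [← lintegral_map hf (measurable_const_smul r), h, lintegral_smul_measure, smul_eq_mul]

lemma lint_tail (hN : 2 ≤ N) {w : ℝ} (hw : 0 < w) :
    ∫⁻ r in Ioi w, ENNReal.ofReal ((r ^ (N+1))⁻¹) = ENNReal.ofReal ((w ^ N)⁻¹ / N) := by
  have h1 : ∀ r ∈ Ioi w, ENNReal.ofReal ((r ^ (N+1))⁻¹) = ENNReal.ofReal (r ^ (-(N+1:ℝ))) := by
    intro r hr
    have : 0 < r := hw.trans hr
    rw [Real.rpow_neg this.le]
    norm_cast
  have hN' : (2:ℝ) ≤ N := by exact_mod_cast hN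
  rw [setLIntegral_congr_fun measurableSet_Ioi h1, ← ofReal_integral_eq_lintegral_ofReal,
    integral_Ioi_rpow_of_lt (by linarith) hw]
  · congr 1
    have : (-(N+1:ℝ)+1) = -(N:ℝ) := by ring
    rw [this, Real.rpow_neg hw.le, Real.rpow_natCast]
    field_simp
  · exact integrableOn_Ioi_rpow_of_lt (by linarith) hw
  · filter_upwards [ae_restrict_mem measurableSet_Ioi] with r hr
    have : 0 < r := hw.trans hr
    positivity

/-- the kernel `|z|^{1-N}` -/
noncomputable def ker (N : ℕ) (z : EuclideanSpace ℝ (Fin N)) : ℝ≥0∞ :=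
  ENNReal.ofReal ((‖z‖ ^ (N-1))⁻¹)

lemma measurable_ker : Measurable (ker N) := by
  unfold ker; fun_prop

/-- averaging over directions -/
lemma avg_rays (hN : 2 ≤ N) (f : EuclideanSpace ℝ (Fin N) → ℝ≥0∞) (hf : Measurable f) {h : ℝ≥0∞}
    (hh : ∀ z, z ≠ 0 → h ≤ ∫⁻ r in Ioi (0:ℝ), f (r • z) * ‖z‖ₑ) :
    h * (N * volume (Metric.ball (0 : EuclideanSpace ℝ (Fin N)) 1)) ≤ ∫⁻ z, f z * ker N z := by
  set Bl := Metric.ball (0 : EuclideanSpace ℝ (Fin N)) 1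
  have hN0 : (N:ℝ) ≠ 0 := by positivity
  have : NeZero N := ⟨by omega⟩
  have key : h * volume Bl ≤ ∫⁻ z, f z * ker N z * ENNReal.ofReal (1 / N) := by
    calc h * volume Bl = ∫⁻ z in Bl, h := by simp
      _ ≤ ∫⁻ z in Bl, ∫⁻ r in Ioi (0:ℝ), f (r • z) * ‖z‖ₑ := by
          refine lintegral_mono_ae ?_
          have : ∀ᵐ z ∂(volume.restrict Bl), z ≠ 0 := by
            refine ae_restrict_of_ae ?_
            rw [ae_iff]; simp
          filter_upwards [this] with z hz using hh z hz
      _ = ∫⁻ z, ∫⁻ r in Ioi (0:ℝ), Bl.indicator (fun z => ‖z‖ₑ) z * f (r • z) := by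
          rw [← lintegral_indicator (show MeasurableSet Bl from Metric.isOpen_ball.measurableSet)]
          congr 1; ext z
          by_cases hz : z ∈ Bl
          · simp only [indicator_of_mem hz]; exact lintegral_congr fun r => mul_comm _ _
          · simp only [indicator_of_notMem hz, zero_mul, lintegral_zero]
      _ = ∫⁻ r in Ioi (0:ℝ), ∫⁻ z, Bl.indicator (fun z => ‖z‖ₑ) z * f (r • z) := by
          refine lintegral_lintegral_swap ?_
          refine Measurable.aemeasurable ?_
          refine Measurable.mul ?_ ?_
          · exact (measurable_enorm.indicator Metric.isOpen_ball.measurableSet).comp measurable_fst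
          · exact hf.comp (by fun_prop)
      _ = ∫⁻ r in Ioi (0:ℝ), ∫⁻ z, (f z * ‖z‖ₑ) *
            (Ioi ‖z‖).indicator (fun r => ENNReal.ofReal ((r ^ (N+1))⁻¹)) r := by
          refine setLIntegral_congr_fun measurableSet_Ioi ?_
          intro r (hr : 0 < r)
          simp only
          have h1 : ∀ z : EuclideanSpace ℝ (Fin N), Bl.indicator (fun z => ‖z‖ₑ) z * f (r • z) =
            (fun w => {w : EuclideanSpace ℝ (Fin N) | ‖w‖ < r}.indicator
              (fun w => ‖w‖ₑ * ENNReal.ofReal (r⁻¹)) w * f w) (r • z) := by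
            intro z
            simp only
            congr 1
            have hiff : z ∈ Bl ↔ r • z ∈ {w : EuclideanSpace ℝ (Fin N) | ‖w‖ < r} := by
              simp only [Bl, Metric.mem_ball, dist_zero_right, mem_ofPred_eq, norm_smul,
                Real.norm_eq_abs, abs_of_pos hr]
              constructor
              · intro h; nlinarith
              · intro h; by_contra h'; nlinarith
            by_cases hz : z ∈ Bl
            · rw [indicator_of_mem hz, indicator_of_mem (hiff.1 hz)]
              rw [enorm_smul, Real.enorm_eq_ofReal hr.le, mul_comm, ← mul_assoc,
                ← ENNReal.ofReal_mul (by positivity), inv_mul_cancel₀ hr.ne']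
              simp
            · rw [indicator_of_notMem hz, indicator_of_notMem (mt hiff.2 hz)]
          rw [lintegral_congr h1, lintegral_scale (fun w => {w : EuclideanSpace ℝ (Fin N) | ‖w‖ < r}.indicator
              (fun w => ‖w‖ₑ * ENNReal.ofReal (r⁻¹)) w * f w) _ hr]
          · rw [← lintegral_const_mul]
            · congr 1; ext z
              by_cases hz : ‖z‖ < r
              · rw [indicator_of_mem (show z ∈ {w : EuclideanSpace ℝ (Fin N) | ‖w‖ < r} from hz),
                  indicator_of_mem (show r ∈ Ioi ‖z‖ from hz), pow_succ, mul_inv,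
                  ENNReal.ofReal_mul (by positivity)]
                ring
              · rw [indicator_of_notMem (show z ∉ {w : EuclideanSpace ℝ (Fin N) | ‖w‖ < r} from hz),
                  indicator_of_notMem (show r ∉ Ioi ‖z‖ from hz)]
                simp
            · refine Measurable.mul (Measurable.indicator (by fun_prop) ?_) hf
              exact measurableSet_lt (by fun_prop) (by fun_prop)
          · refine Measurable.mul (Measurable.indicator (by fun_prop) ?_) hf
            exact measurableSet_lt (by fun_prop) (by fun_prop)
      _ = ∫⁻ z, ∫⁻ r in Ioi (0:ℝ), (f z * ‖z‖ₑ) *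
            (Ioi ‖z‖).indicator (fun r => ENNReal.ofReal ((r ^ (N+1))⁻¹)) r := by
          refine lintegral_lintegral_swap ?_
          refine Measurable.aemeasurable ?_
          have hm : Measurable (fun p : ℝ × EuclideanSpace ℝ (Fin N) =>
              {p : ℝ × EuclideanSpace ℝ (Fin N) | ‖p.2‖ < p.1}.indicator
              (fun p => ENNReal.ofReal ((p.1 ^ (N+1))⁻¹)) p) :=
            Measurable.indicator (by fun_prop) (measurableSet_lt (by fun_prop) (by fun_prop))
          refine Measurable.mul ?_ ?_
          · exact (hf.mul measurable_enorm).comp measurable_snd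
          · exact hm
      _ = ∫⁻ z, f z * ker N z * ENNReal.ofReal (1 / N) := by
          refine lintegral_congr_ae ?_
          have : ∀ᵐ z : EuclideanSpace ℝ (Fin N), z ≠ 0 := by
            rw [ae_iff]; simp
          filter_upwards [this] with z hz
          have hzn : 0 < ‖z‖ := norm_pos_iff.2 hz
          rw [lintegral_const_mul, lintegral_indicator measurableSet_Ioi,
            Measure.restrict_restrict measurableSet_Ioi,
            inter_eq_self_of_subset_left (Ioi_subset_Ioi hzn.le), lint_tail hN hzn, mul_assoc,
            mul_assoc]
          · congr 1
            rw [ker, ← ENNReal.ofReal_mul (by positivity), ← ofReal_norm,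
              ← ENNReal.ofReal_mul (by positivity)]
            congr 1
            obtain ⟨n, rfl⟩ : ∃ n, N = n + 1 := ⟨N - 1, by omega⟩
            rw [Nat.add_sub_cancel, pow_succ]
            field_simp
          · exact Measurable.indicator (by fun_prop) measurableSet_Ioi
  rw [lintegral_mul_const _ (show Measurable fun z => f z * ker N z from hf.mul measurable_ker)] at key
  calc h * (N * volume Bl) = N * (h * volume Bl) := by ring
    _ ≤ N * ((∫⁻ z, f z * ker N z) * ENNReal.ofReal (1 / N)) := by gcongr
    _ = (∫⁻ z, f z * ker N z) * (ENNReal.ofReal N * ENNReal.ofReal (1 / N)) := by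
        rw [ENNReal.ofReal_natCast]; ring
    _ = _ := by
        rw [← ENNReal.ofReal_mul (by positivity), mul_one_div_cancel hN0]; simp

lemma potential_bound (hN : 2 ≤ N) {u : EuclideanSpace ℝ (Fin N) → ℝ} (hu : ContDiff ℝ 1 u)
    (hc : HasCompactSupport u)
    {s t : ℝ} (hs : 0 ≤ s) (hst : s < t) (x : EuclideanSpace ℝ (Fin N))
    (hx : t ≤ |u x|) :
    ENNReal.ofReal (t - s) * (N * volume (Metric.ball (0 : EuclideanSpace ℝ (Fin N)) 1)) ≤
      ∫⁻ y in {y | s < |u y| ∧ |u y| < t}, ‖fderiv ℝ u y‖ₑ * ker N (y - x) := by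
  have hmeas : MeasurableSet {y | s < |u y| ∧ |u y| < t} :=
    (measurableSet_lt measurable_const hu.continuous.measurable.norm).inter
      (measurableSet_lt hu.continuous.measurable.norm measurable_const)
  have hfm : Measurable ({y | s < |u y| ∧ |u y| < t}.indicator (fun y => ‖fderiv ℝ u y‖ₑ)) := by
    refine Measurable.indicator ?_ hmeas
    exact (hu.continuous_fderiv (by norm_num)).measurable.enorm
  have := avg_rays hN (fun z => {y | s < |u y| ∧ |u y| < t}.indicator
    (fun y => ‖fderiv ℝ u y‖ₑ) (x + z)) (hfm.comp (measurable_const_add x))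
    (fun z hz => ray_test hu hc hs hst x z hz hx)
  refine this.trans_eq ?_
  rw [← lintegral_indicator hmeas]
  refine Eq.trans ?_ (lintegral_add_left_eq_self _ x)
  refine lintegral_congr fun z => ?_
  by_cases h : x + z ∈ {y | s < |u y| ∧ |u y| < t}
  · simp only [indicator_of_mem h, add_sub_cancel_left]
  · simp only [indicator_of_notMem h, zero_mul]



/-- volume of the unit ball -/
noncomputable def bN (N : ℕ) : ℝ := volume.real (Metric.ball (0 : EuclideanSpace ℝ (Fin N)) 1)

lemma bN_pos : 0 < bN N := by
  unfold bN
  rw [Measure.real, ENNReal.toReal_pos_iff]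
  exact ⟨Metric.measure_ball_pos _ _ one_pos, measure_ball_lt_top⟩

lemma vol_unit : volume (Metric.ball (0 : EuclideanSpace ℝ (Fin N)) 1) = ENNReal.ofReal (bN N) := by
  unfold bN
  rw [Measure.real, ENNReal.ofReal_toReal measure_ball_lt_top.ne]

lemma lint_radial (hN : 2 ≤ N) (g : ℝ → ℝ) (hg : ∀ y, 0 ≤ y → 0 ≤ g y)
    (hi : IntegrableOn (fun y : ℝ => y ^ (N-1) * g y) (Ioi 0)) :
    ∫⁻ z : EuclideanSpace ℝ (Fin N), ENNReal.ofReal (g ‖z‖) =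
      ENNReal.ofReal (N * bN N * ∫ y in Ioi (0:ℝ), y ^ (N-1) * g y) := by
  have : NeZero N := ⟨by omega⟩
  have hi' : Integrable (fun z : EuclideanSpace ℝ (Fin N) => g ‖z‖) := by
    rw [integrable_fun_norm_addHaar (volume : Measure (EuclideanSpace ℝ (Fin N)))]
    simpa using hi
  have h2 := integral_fun_norm_addHaar (volume : Measure (EuclideanSpace ℝ (Fin N))) g
  rw [← ofReal_integral_eq_lintegral_ofReal hi' (.of_forall fun z => hg _ (norm_nonneg _)), h2]
  simp only [finrank_euclideanSpace, Fintype.card_fin, smul_eq_mul, nsmul_eq_mul, bN, mul_assoc]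

lemma lint_small (hN : 2 ≤ N) {ρ : ℝ} (hρ : 0 < ρ) :
    ∫⁻ z, {z : EuclideanSpace ℝ (Fin N) | ‖z‖ ≤ ρ}.indicator (ker N) z =
      ENNReal.ofReal (N * bN N * ρ) := by
  have e : ∀ y ∈ Ioi (0:ℝ), y ^ (N-1) * (Iic ρ).indicator (fun y => (y^(N-1))⁻¹) y =
      (Ioc 0 ρ).indicator (fun _ => (1:ℝ)) y := by
    intro y (hy : 0 < y)
    by_cases h : y ≤ ρ
    · rw [indicator_of_mem (show y ∈ Iic ρ from h), indicator_of_mem (show y ∈ Ioc 0 ρ from ⟨hy, h⟩)]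
      field_simp
    · rw [indicator_of_notMem (show y ∉ Iic ρ from h),
        indicator_of_notMem (show y ∉ Ioc 0 ρ from fun h' => h h'.2), mul_zero]
  have := lint_radial hN (fun y => (Iic ρ).indicator (fun y => (y^(N-1))⁻¹) y) ?_ ?_
  · rw [setIntegral_congr_fun measurableSet_Ioi e, setIntegral_indicator measurableSet_Ioc,
      inter_eq_self_of_subset_right Ioc_subset_Ioi_self] at this
    rw [setIntegral_const, measureReal_def, Real.volume_Ioc, ENNReal.toReal_ofReal (by linarith)] at this
    simp only [sub_zero, smul_eq_mul, mul_one] at this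
    rw [← this]
    refine lintegral_congr fun z => ?_
    by_cases h : ‖z‖ ≤ ρ
    · rw [indicator_of_mem (show ‖z‖ ∈ Iic ρ from h),
        indicator_of_mem (show z ∈ {z : EuclideanSpace ℝ (Fin N) | ‖z‖ ≤ ρ} from h), ker]
    · rw [indicator_of_notMem (show ‖z‖ ∉ Iic ρ from h),
        indicator_of_notMem (show z ∉ {z : EuclideanSpace ℝ (Fin N) | ‖z‖ ≤ ρ} from h)]
      simp
  · intro y hy
    by_cases h : y ∈ Iic ρ
    · rw [indicator_of_mem h]; positivity
    · rw [indicator_of_notMem h]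
  · refine IntegrableOn.congr_fun ?_ (fun y hy => (e y hy).symm) measurableSet_Ioi
    refine Integrable.integrableOn ?_
    rw [integrable_indicator_iff measurableSet_Ioc]
    exact integrableOn_const (by simp)

lemma lint_annulus (hN : 2 ≤ N) {ρ R : ℝ} (hρ : 0 < ρ) (hR : ρ ≤ R) :
    ∫⁻ z, {z : EuclideanSpace ℝ (Fin N) | ρ < ‖z‖ ∧ ‖z‖ ≤ R}.indicator
        (fun z => ENNReal.ofReal ((‖z‖ ^ N)⁻¹)) z =
      ENNReal.ofReal (N * bN N * Real.log (R / ρ)) := by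
  have e : ∀ y ∈ Ioi (0:ℝ), y ^ (N-1) * (Ioc ρ R).indicator (fun y => (y^N)⁻¹) y =
      (Ioc ρ R).indicator (fun y => y⁻¹) y := by
    intro y (hy : 0 < y)
    by_cases h : y ∈ Ioc ρ R
    · rw [indicator_of_mem h, indicator_of_mem h]
      obtain ⟨n, rfl⟩ : ∃ n, N = n + 1 := ⟨N - 1, by omega⟩
      rw [Nat.add_sub_cancel, pow_succ]
      field_simp
    · rw [indicator_of_notMem h, indicator_of_notMem h, mul_zero]
  have h0 : (0:ℝ) ∉ uIcc ρ R := by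
    rw [uIcc_of_le hR]; intro h; linarith [h.1]
  have := lint_radial hN (fun y => (Ioc ρ R).indicator (fun y => (y^N)⁻¹) y) ?_ ?_
  · rw [setIntegral_congr_fun measurableSet_Ioi e, setIntegral_indicator measurableSet_Ioc,
      inter_eq_self_of_subset_right (Ioc_subset_Ioi_self.trans (Ioi_subset_Ioi hρ.le)),
      ← intervalIntegral.integral_of_le hR, integral_inv h0] at this
    rw [← this]
    refine lintegral_congr fun z => ?_
    by_cases h : ‖z‖ ∈ Ioc ρ R
    · rw [indicator_of_mem h, indicator_of_mem
        (show z ∈ {z : EuclideanSpace ℝ (Fin N) | ρ < ‖z‖ ∧ ‖z‖ ≤ R} from h)]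
    · rw [indicator_of_notMem h, indicator_of_notMem
        (show z ∉ {z : EuclideanSpace ℝ (Fin N) | ρ < ‖z‖ ∧ ‖z‖ ≤ R} from h)]
      simp
  · intro y hy
    by_cases h : y ∈ Ioc ρ R
    · rw [indicator_of_mem h]; positivity
    · rw [indicator_of_notMem h]
  · refine IntegrableOn.congr_fun ?_ (fun y hy => (e y hy).symm) measurableSet_Ioi
    refine Integrable.integrableOn ?_
    rw [integrable_indicator_iff measurableSet_Ioc]
    refine (ContinuousOn.integrableOn_Icc ?_).mono_set Ioc_subset_Icc_self
    exact continuousOn_inv₀.mono fun y hy => (hρ.trans_le hy.1).ne'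

/-- The conjugate exponent `N/(N-1)`. -/
noncomputable def qN (N : ℕ) : ℝ := (N:ℝ) / ((N:ℝ) - 1)

lemma qN_conj (hN : 2 ≤ N) : (N:ℝ).HolderConjugate (qN N) := by
  have : (2:ℝ) ≤ N := by exact_mod_cast hN
  exact Real.HolderConjugate.conjExponent (by linarith)

lemma qN_sub_one (hN : 2 ≤ N) : qN N - 1 = 1 / ((N:ℝ) - 1) := by
  have : (2:ℝ) ≤ N := by exact_mod_cast hN
  have : (N:ℝ) - 1 ≠ 0 := by linarith
  unfold qN; field_simp; ring

lemma qN_div (hN : 2 ≤ N) : qN N / N = qN N - 1 := by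
  have : (2:ℝ) ≤ N := by exact_mod_cast hN
  have : (N:ℝ) - 1 ≠ 0 := by linarith
  rw [qN_sub_one hN]
  unfold qN; field_simp

lemma qN_gt (hN : 2 ≤ N) : 1 < qN N := by
  have : (2:ℝ) ≤ N := by exact_mod_cast hN
  have h := qN_sub_one hN
  have : 0 < 1 / ((N:ℝ) - 1) := by apply div_pos one_pos; linarith
  linarith

lemma qN_le (hN : 2 ≤ N) : qN N ≤ 2 := by
  have : (2:ℝ) ≤ N := by exact_mod_cast hN
  have h := qN_sub_one hN
  have : 1 / ((N:ℝ) - 1) ≤ 1 := by rw [div_le_one] <;> linarith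
  linarith

lemma cast_pred (hN : 2 ≤ N) : ((N - 1 : ℕ) : ℝ) = (N:ℝ) - 1 := by
  rw [Nat.cast_sub (by omega)]; simp

lemma ker_rpow (hN : 2 ≤ N) {z : EuclideanSpace ℝ (Fin N)} (hz : 0 < ‖z‖) :
    ker N z ^ qN N = ENNReal.ofReal ((‖z‖ ^ N)⁻¹) := by
  have h2 : (2:ℝ) ≤ N := by exact_mod_cast hN
  rw [ker, ENNReal.ofReal_rpow_of_pos (by positivity), Real.inv_rpow (by positivity),
    ← Real.rpow_natCast, ← Real.rpow_mul hz.le, cast_pred hN, ← Real.rpow_natCast]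
  have : ((N:ℝ) - 1) * qN N = N := by
    have : (N:ℝ) - 1 ≠ 0 := by linarith
    unfold qN; field_simp
  rw [this]

lemma k1_int (hN : 2 ≤ N) {ρ R : ℝ} (hρ : 0 < ρ) (hR : ρ ≤ R)
    {G : Set (EuclideanSpace ℝ (Fin N))} (hG : volume G ≤ ENNReal.ofReal (bN N * R ^ N))
    (x : EuclideanSpace ℝ (Fin N)) :
    ∫⁻ y in G, ({z : EuclideanSpace ℝ (Fin N) | ρ < ‖z‖}.indicator (ker N) (y - x)) ^ qN N ≤
      ENNReal.ofReal (N * bN N * Real.log (R / ρ) + bN N) := by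
  have hRpos : 0 < R := hρ.trans_le hR
  have hq := qN_gt hN
  have hb := bN_pos (N := N)
  have hlog : 0 ≤ Real.log (R / ρ) := Real.log_nonneg (by rw [le_div_iff₀ hρ]; linarith)
  have hp : ∀ z : EuclideanSpace ℝ (Fin N),
      ({z : EuclideanSpace ℝ (Fin N) | ρ < ‖z‖}.indicator (ker N) z) ^ qN N ≤
      {z : EuclideanSpace ℝ (Fin N) | ρ < ‖z‖ ∧ ‖z‖ ≤ R}.indicator
        (fun z => ENNReal.ofReal ((‖z‖ ^ N)⁻¹)) z + ENNReal.ofReal ((R ^ N)⁻¹) := by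
    intro z
    by_cases h1 : ρ < ‖z‖
    · rw [indicator_of_mem (show z ∈ {z : EuclideanSpace ℝ (Fin N) | ρ < ‖z‖} from h1),
        ker_rpow hN (hρ.trans h1)]
      by_cases h2 : ‖z‖ ≤ R
      · rw [indicator_of_mem
          (show z ∈ {z : EuclideanSpace ℝ (Fin N) | ρ < ‖z‖ ∧ ‖z‖ ≤ R} from ⟨h1, h2⟩)]
        exact le_self_add
      · refine le_trans ?_ le_add_self
        apply ENNReal.ofReal_le_ofReal
        have := not_le.1 h2
        gcongr
    · rw [indicator_of_notMem (show z ∉ {z : EuclideanSpace ℝ (Fin N) | ρ < ‖z‖} from h1),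
        ENNReal.zero_rpow_of_pos (by linarith)]
      exact zero_le
  calc _ ≤ ∫⁻ y in G, ({z : EuclideanSpace ℝ (Fin N) | ρ < ‖z‖ ∧ ‖z‖ ≤ R}.indicator
        (fun z => ENNReal.ofReal ((‖z‖ ^ N)⁻¹)) (y - x) + ENNReal.ofReal ((R ^ N)⁻¹)) :=
        lintegral_mono fun y => hp _
    _ = (∫⁻ y in G, {z : EuclideanSpace ℝ (Fin N) | ρ < ‖z‖ ∧ ‖z‖ ≤ R}.indicator
        (fun z => ENNReal.ofReal ((‖z‖ ^ N)⁻¹)) (y - x)) + ENNReal.ofReal ((R ^ N)⁻¹) * volume G := by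
        rw [lintegral_add_right _ measurable_const]; simp
    _ ≤ (∫⁻ y, {z : EuclideanSpace ℝ (Fin N) | ρ < ‖z‖ ∧ ‖z‖ ≤ R}.indicator
        (fun z => ENNReal.ofReal ((‖z‖ ^ N)⁻¹)) (y - x)) +
          ENNReal.ofReal ((R ^ N)⁻¹) * ENNReal.ofReal (bN N * R ^ N) := by
        gcongr
        exact Measure.restrict_le_self
    _ = _ := by
        rw [lintegral_sub_right_eq_self (fun z => {z : EuclideanSpace ℝ (Fin N) |
          ρ < ‖z‖ ∧ ‖z‖ ≤ R}.indicator (fun z => ENNReal.ofReal ((‖z‖ ^ N)⁻¹)) z) x,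
          lint_annulus hN hρ hR, ← ENNReal.ofReal_mul (by positivity),
          ← ENNReal.ofReal_add (by positivity) (by positivity)]
        congr 2
        field_simp

lemma jensen_q (hN : 2 ≤ N) {F : Set (EuclideanSpace ℝ (Fin N))}
    {f : EuclideanSpace ℝ (Fin N) → ℝ≥0∞} (hf : Measurable f) :
    (∫⁻ x in F, f x) ^ qN N ≤ volume F ^ (qN N - 1) * ∫⁻ x in F, f x ^ qN N := by
  have hq := qN_gt hN
  have h := ENNReal.lintegral_mul_le_Lp_mul_Lq (volume.restrict F) (qN_conj hN).symm
    hf.aemeasurable (g := fun _ => 1) aemeasurable_const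
  simp only [Pi.mul_apply, mul_one, ENNReal.one_rpow, lintegral_const, one_mul,
    Measure.restrict_apply_univ] at h
  calc _ ≤ ((∫⁻ x in F, f x ^ qN N) ^ (1 / qN N) * volume F ^ (1 / (N:ℝ))) ^ qN N := by
        gcongr
    _ = _ := by
        rw [ENNReal.mul_rpow_of_nonneg _ _ (by linarith), ← ENNReal.rpow_mul, ← ENNReal.rpow_mul,
          one_div_mul_cancel (by linarith), ENNReal.rpow_one, ← qN_div hN, mul_comm]
        congr 2
        ring

lemma add_rpow_aux {a b M q : ℝ} (ha : 0 ≤ a) (hb : 0 ≤ b) (hq : 1 < q) (hq2 : q ≤ 2)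
    (hM : a + b ≤ M) : (a + b) ^ q ≤ a ^ q + 2 * (b * M ^ (q - 1)) := by
  rcases (add_nonneg ha hb).eq_or_lt with h | h
  · rw [← h, Real.zero_rpow (by linarith)]
    have : 0 ≤ M := by linarith
    positivity
  · set c := a + b with hc
    have h1 := one_add_mul_self_le_rpow_one_add (s := - (b / c)) (p := q)
      (by rw [neg_le_neg_iff, div_le_one h]; linarith) hq.le
    have h2 : 1 + -(b / c) = a / c := by field_simp; linarith
    rw [h2, Real.div_rpow ha h.le, le_div_iff₀ (by positivity)] at h1
    have h3 : c ^ q = c ^ (q - 1) * c := by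
      rw [← Real.rpow_add_one h.ne']; congr 1; ring
    have h4 : q * (b * c ^ (q-1)) ≤ 2 * (b * M ^ (q - 1)) := by
      gcongr
    have h5 : (b / c) * c ^ q = b * c ^ (q - 1) := by rw [h3]; field_simp
    have h6 : (1 + q * -(b / c)) * c ^ q = c ^ q - q * ((b / c) * c ^ q) := by ring
    rw [h6, h5] at h1
    linarith

lemma add_rpow_aux' {a b M : ℝ≥0∞} {q : ℝ} (hq : 1 < q) (hq2 : q ≤ 2)
    (hM : a + b ≤ M) (hMt : M ≠ ⊤) : (a + b) ^ q ≤ a ^ q + 2 * (b * M ^ (q - 1)) := by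
  have hab : a + b ≠ ⊤ := ne_top_of_le_ne_top hMt hM
  have ha : a ≠ ⊤ := fun h => hab (by simp [h])
  have hb : b ≠ ⊤ := fun h => hab (by simp [h])
  lift a to NNReal using ha
  lift b to NNReal using hb
  lift M to NNReal using hMt
  have h := add_rpow_aux a.2 b.2 hq hq2 (M := M) (by exact_mod_cast hM)
  rw [← ENNReal.coe_add, ← ENNReal.coe_rpow_of_nonneg _ (by linarith),
    ← ENNReal.coe_rpow_of_nonneg _ (by linarith), ← ENNReal.coe_rpow_of_nonneg _ (by linarith)]
  exact_mod_cast h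

lemma kernel_norm (hN : 2 ≤ N) {ρ R : ℝ} (hρ : 0 < ρ) (hR : ρ ≤ R)
    {F G : Set (EuclideanSpace ℝ (Fin N))} (hFm : MeasurableSet F) (hGm : MeasurableSet G)
    (hF : ENNReal.ofReal (bN N * ρ ^ N) ≤ volume F) (hFt : volume F ≠ ⊤)
    (hG : volume G ≤ ENNReal.ofReal (bN N * R ^ N)) :
    ∫⁻ y in G, (∫⁻ x in F, ker N (y - x)) ^ qN N ≤ volume F ^ qN N *
      ENNReal.ofReal (N * bN N * Real.log (R / ρ) + bN N + 2 * (N + 1) * N * bN N) := by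
  have hq := qN_gt hN
  have hq2 := qN_le hN
  have hb := bN_pos (N := N)
  have h2N : (2:ℝ) ≤ N := by exact_mod_cast hN
  have hlog : 0 ≤ Real.log (R / ρ) := Real.log_nonneg (by rw [le_div_iff₀ hρ]; linarith)
  set k1 : EuclideanSpace ℝ (Fin N) → ℝ≥0∞ :=
    {z : EuclideanSpace ℝ (Fin N) | ρ < ‖z‖}.indicator (ker N) with hk1
  set k2 : EuclideanSpace ℝ (Fin N) → ℝ≥0∞ :=
    {z : EuclideanSpace ℝ (Fin N) | ‖z‖ ≤ ρ}.indicator (ker N) with hk2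
  have hk1m : Measurable k1 :=
    measurable_ker.indicator (measurableSet_lt measurable_const measurable_norm)
  have hk2m : Measurable k2 :=
    measurable_ker.indicator (measurableSet_le measurable_norm measurable_const)
  set m := volume F with hm
  have hm0 : m ≠ 0 := fun h => by
    rw [h] at hF
    have : 0 < ENNReal.ofReal (bN N * ρ ^ N) := ENNReal.ofReal_pos.2 (by positivity)
    exact absurd hF (not_le.2 this)
  have hsum : ∀ z, ker N z = k1 z + k2 z := by
    intro z
    by_cases h : ρ < ‖z‖
    · simp only [hk1, hk2]
      rw [indicator_of_mem (show z ∈ {z : EuclideanSpace ℝ (Fin N) | ρ < ‖z‖} from h),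
        indicator_of_notMem (show z ∉ {z : EuclideanSpace ℝ (Fin N) | ‖z‖ ≤ ρ} from not_le.2 h),
        add_zero]
    · simp only [hk1, hk2]
      rw [indicator_of_notMem (show z ∉ {z : EuclideanSpace ℝ (Fin N) | ρ < ‖z‖} from h),
        indicator_of_mem (show z ∈ {z : EuclideanSpace ℝ (Fin N) | ‖z‖ ≤ ρ} from not_lt.1 h),
        zero_add]
  have hKsum : ∀ y, ∫⁻ x in F, ker N (y - x) = (∫⁻ x in F, k1 (y - x)) + ∫⁻ x in F, k2 (y - x) := by
    intro y
    simp only [hsum]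
    exact lintegral_add_left (hk1m.comp (by fun_prop)) _
  set M : ℝ≥0∞ := m * ENNReal.ofReal ((N + 1) * (ρ ^ (N-1))⁻¹) with hM
  have hMt : M ≠ ⊤ := ENNReal.mul_ne_top hFt ENNReal.ofReal_ne_top
  have hK1le : ∀ y, ∫⁻ x in F, k1 (y - x) ≤ m * ENNReal.ofReal ((ρ ^ (N-1))⁻¹) := by
    intro y
    calc ∫⁻ x in F, k1 (y - x) ≤ ∫⁻ x in F, ENNReal.ofReal ((ρ ^ (N-1))⁻¹) := by
          refine lintegral_mono fun x => ?_
          simp only [hk1]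
          by_cases h : ρ < ‖y - x‖
          · rw [indicator_of_mem
              (show y - x ∈ {z : EuclideanSpace ℝ (Fin N) | ρ < ‖z‖} from h), ker]
            apply ENNReal.ofReal_le_ofReal
            gcongr
          · rw [indicator_of_notMem
              (show y - x ∉ {z : EuclideanSpace ℝ (Fin N) | ρ < ‖z‖} from h)]
            exact zero_le
      _ = _ := by simp [mul_comm, hm]
  have hK2le : ∀ y, ∫⁻ x in F, k2 (y - x) ≤ m * ENNReal.ofReal (N * (ρ ^ (N-1))⁻¹) := by
    intro y
    calc ∫⁻ x in F, k2 (y - x) ≤ ∫⁻ x, k2 (y - x) := lintegral_mono' Measure.restrict_le_self le_rfl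
      _ = ∫⁻ x, k2 x := lintegral_sub_left_eq_self _ y
      _ = ENNReal.ofReal (N * bN N * ρ) := lint_small hN hρ
      _ = ENNReal.ofReal (bN N * ρ ^ N) * ENNReal.ofReal (N * (ρ ^ (N-1))⁻¹) := by
          rw [← ENNReal.ofReal_mul (by positivity)]
          congr 1
          obtain ⟨n, rfl⟩ : ∃ n, N = n + 1 := ⟨N - 1, by omega⟩
          rw [Nat.add_sub_cancel, pow_succ]
          field_simp
      _ ≤ _ := by gcongr
  have hKM : ∀ y, (∫⁻ x in F, k1 (y - x)) + ∫⁻ x in F, k2 (y - x) ≤ M := by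
    intro y
    refine (add_le_add (hK1le y) (hK2le y)).trans_eq ?_
    rw [hM, ← mul_add, ← ENNReal.ofReal_add (by positivity) (by positivity)]
    congr 2; ring
  have hMq : M ^ (qN N - 1) ≤ m ^ (qN N - 1) * ENNReal.ofReal ((N+1) * ρ⁻¹) := by
    rw [hM, ENNReal.mul_rpow_of_nonneg _ _ (by linarith)]
    gcongr
    rw [ENNReal.ofReal_rpow_of_pos (by positivity)]
    apply ENNReal.ofReal_le_ofReal
    rw [Real.mul_rpow (by positivity) (by positivity)]
    have e1 : ((ρ ^ (N-1))⁻¹) ^ (qN N - 1) = ρ⁻¹ := by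
      rw [Real.inv_rpow (by positivity), ← Real.rpow_natCast, ← Real.rpow_mul hρ.le, cast_pred hN,
        qN_sub_one hN, mul_one_div_cancel (by linarith), Real.rpow_one]
    rw [e1]
    gcongr
    calc ((N:ℝ)+1) ^ (qN N - 1) ≤ ((N:ℝ)+1) ^ (1:ℝ) :=
          Real.rpow_le_rpow_of_exponent_le (by linarith) (by linarith)
      _ = _ := Real.rpow_one _
  have hK1m : Measurable fun y => ∫⁻ x in F, k1 (y - x) :=
    Measurable.lintegral_prod_right' (f := fun p : EuclideanSpace ℝ (Fin N) ×
      EuclideanSpace ℝ (Fin N) => k1 (p.1 - p.2)) (hk1m.comp (by fun_prop))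
  have hK2m : Measurable fun y => ∫⁻ x in F, k2 (y - x) :=
    Measurable.lintegral_prod_right' (f := fun p : EuclideanSpace ℝ (Fin N) ×
      EuclideanSpace ℝ (Fin N) => k2 (p.1 - p.2)) (hk2m.comp (by fun_prop))
  have I2 : ∫⁻ y in G, ∫⁻ x in F, k2 (y - x) ≤ m * ENNReal.ofReal (N * bN N * ρ) := by
    calc _ ≤ ∫⁻ y, ∫⁻ x in F, k2 (y - x) := lintegral_mono' Measure.restrict_le_self le_rfl
      _ = ∫⁻ x in F, ∫⁻ y, k2 (y - x) :=
          lintegral_lintegral_swap (hk2m.comp (by fun_prop)).aemeasurable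
      _ = ∫⁻ x in F, ENNReal.ofReal (N * bN N * ρ) := by
          refine lintegral_congr fun x => ?_
          rw [lintegral_sub_right_eq_self k2 x]; exact lint_small hN hρ
      _ = _ := by simp [mul_comm, hm]
  have I1 : ∫⁻ y in G, (∫⁻ x in F, k1 (y - x)) ^ qN N ≤
      m ^ (qN N - 1) * (m * ENNReal.ofReal (N * bN N * Real.log (R / ρ) + bN N)) := by
    calc _ ≤ ∫⁻ y in G, m ^ (qN N - 1) * ∫⁻ x in F, k1 (y - x) ^ qN N :=
          lintegral_mono fun y => jensen_q hN (hk1m.comp (by fun_prop))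
      _ = m ^ (qN N - 1) * ∫⁻ y in G, ∫⁻ x in F, k1 (y - x) ^ qN N := by
          rw [lintegral_const_mul']
          exact ENNReal.rpow_ne_top_of_nonneg (by linarith) hFt
      _ = m ^ (qN N - 1) * ∫⁻ x in F, ∫⁻ y in G, k1 (y - x) ^ qN N := by
          rw [lintegral_lintegral_swap]
          exact ((hk1m.comp (by fun_prop)).pow_const _).aemeasurable
      _ ≤ m ^ (qN N - 1) * ∫⁻ x in F, ENNReal.ofReal (N * bN N * Real.log (R / ρ) + bN N) := by
          gcongr with x
          exact k1_int hN hρ hR hG x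
      _ = _ := by simp [mul_comm, hm]
  calc _ = ∫⁻ y in G, ((∫⁻ x in F, k1 (y - x)) + ∫⁻ x in F, k2 (y - x)) ^ qN N := by
        simp only [hKsum]
    _ ≤ ∫⁻ y in G, ((∫⁻ x in F, k1 (y - x)) ^ qN N +
          2 * ((∫⁻ x in F, k2 (y - x)) * M ^ (qN N - 1))) :=
        lintegral_mono fun y => add_rpow_aux' hq hq2 (hKM y) hMt
    _ = (∫⁻ y in G, (∫⁻ x in F, k1 (y - x)) ^ qN N) +
          2 * ((∫⁻ y in G, ∫⁻ x in F, k2 (y - x)) * M ^ (qN N - 1)) := by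
        rw [lintegral_add_left (hK1m.pow_const _), lintegral_const_mul' _ _ (by simp),
          lintegral_mul_const _ hK2m]
    _ ≤ m ^ (qN N - 1) * (m * ENNReal.ofReal (N * bN N * Real.log (R / ρ) + bN N)) +
          2 * ((m * ENNReal.ofReal (N * bN N * ρ)) *
            (m ^ (qN N - 1) * ENNReal.ofReal ((N+1) * ρ⁻¹))) := by
        gcongr
    _ = m ^ qN N * (ENNReal.ofReal (N * bN N * Real.log (R / ρ) + bN N) +
          ENNReal.ofReal 2 * (ENNReal.ofReal (N * bN N * ρ) * ENNReal.ofReal ((N+1) * ρ⁻¹))) := by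
        have : m ^ qN N = m ^ (qN N - 1) * m := by
          conv_rhs => rw [← ENNReal.rpow_one m, ← ENNReal.rpow_mul, one_mul,
            ← ENNReal.rpow_add _ _ hm0 hFt]
          congr 1; ring
        rw [this, ENNReal.ofReal_ofNat]; ring
    _ = _ := by
        rw [← ENNReal.ofReal_mul (by positivity), ← ENNReal.ofReal_mul (by positivity),
          ← ENNReal.ofReal_add (by positivity) (by positivity)]
        congr 2
        field_simp


lemma sphereVol_eq (hN : 2 ≤ N) : sphereVol N = N * bN N := by
  have : NeZero N := ⟨by omega⟩
  unfold sphereVol bN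
  rw [Measure.real, EuclideanSpace.volume_ball]
  have hG : 0 < Real.Gamma ((N:ℝ) / 2 + 1) := Real.Gamma_pos_of_pos (by positivity)
  simp only [ENNReal.ofReal_one, one_pow, one_mul, Fintype.card_fin]
  rw [ENNReal.toReal_ofReal (by positivity), mul_div_assoc]
  congr 2
  rw [Real.sqrt_eq_rpow, ← Real.rpow_natCast, ← Real.rpow_mul Real.pi_pos.le]
  congr 1; ring

lemma alpha_pos (hN : 2 ≤ N) : 0 < alphaMT N := by
  unfold alphaMT
  rw [sphereVol_eq hN]
  have := bN_pos (N := N)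
  have : (0:ℝ) < N := by positivity
  positivity

lemma alpha_rel (hN : 2 ≤ N) :
    alphaMT N ^ (1 / qN N) * bN N ^ (1 / qN N) = N * bN N := by
  have hb := bN_pos (N := N)
  have hN0 : (0:ℝ) < N := by positivity
  have hq := qN_gt hN
  rw [← Real.mul_rpow (alpha_pos hN).le hb.le]
  have : alphaMT N * bN N = (N * bN N) ^ qN N := by
    unfold alphaMT
    rw [sphereVol_eq hN]
    have : qN N = 1 / ((N:ℝ) - 1) + 1 := by rw [← qN_sub_one hN]; ring
    rw [this, Real.rpow_add_one (by positivity)]; ring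
  rw [this, ← Real.rpow_mul (by positivity), mul_one_div_cancel (by linarith), Real.rpow_one]

/-- the energy of `u` on a set -/
noncomputable def en (u : EuclideanSpace ℝ (Fin N) → ℝ) (S : Set (EuclideanSpace ℝ (Fin N))) : ℝ :=
  ∫ y in S, ‖fderiv ℝ u y‖ ^ N

lemma en_integrable (hN : 2 ≤ N) {u : EuclideanSpace ℝ (Fin N) → ℝ} (hu : ContDiff ℝ 1 u)
    (hc : HasCompactSupport u) : Integrable (fun y => ‖fderiv ℝ u y‖ ^ N) := by
  refine Continuous.integrable_of_hasCompactSupport ?_ ?_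
  · exact ((hu.continuous_fderiv (by norm_num)).norm).pow N
  · exact (hc.fderiv ℝ).comp_left (g := fun L => ‖L‖ ^ N) (by simp; omega)

/-- additive constant -/
noncomputable def cN (N : ℕ) : ℝ := 1 + 2 * (N + 1) * N

lemma cN_pos : 0 < cN N := by unfold cN; positivity

lemma vol_level_lt_top {u : EuclideanSpace ℝ (Fin N) → ℝ}
    (hc : HasCompactSupport u) : volume {y | u y ≠ 0} < ⊤ :=
  (measure_mono (subset_tsupport u)).trans_lt hc.isCompact.measure_lt_top

lemma level_ineq (hN : 2 ≤ N) {u : EuclideanSpace ℝ (Fin N) → ℝ} (hu : ContDiff ℝ 1 u)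
    (hc : HasCompactSupport u) {s t i j : ℝ} (hs : 0 ≤ s) (hst : s < t) (hij : i ≤ j)
    (ht : ENNReal.ofReal (Real.exp (-j)) ≤ volume {y | t ≤ |u y|})
    (hsv : volume {y | s < |u y|} ≤ ENNReal.ofReal (Real.exp (-i))) :
    alphaMT N ^ (1 / qN N) * (t - s) ≤
      (j - i + cN N) ^ (1 / qN N) * en u {y | s < |u y| ∧ |u y| < t} ^ (1 / (N:ℝ)) := by
  have hq := qN_gt hN
  have hb := bN_pos (N := N)
  have hcN := cN_pos (N := N)
  have hN0 : (0:ℝ) < N := by positivity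
  have hmabs : Measurable fun y => |u y| := hu.continuous.measurable.norm
  set F := {y | t ≤ |u y|} with hF
  set G := {y | s < |u y| ∧ |u y| < t} with hG
  have hFm : MeasurableSet F := measurableSet_le measurable_const hmabs
  have hGm : MeasurableSet G :=
    (measurableSet_lt measurable_const hmabs).inter (measurableSet_lt hmabs measurable_const)
  have hFt : volume F ≠ ⊤ := by
    refine ((measure_mono ?_).trans_lt (vol_level_lt_top hc)).ne
    intro y (hy : t ≤ |u y|) h0
    rw [h0, abs_zero] at hy
    linarith
  set ρ : ℝ := (Real.exp (-j) / bN N) ^ (1 / (N:ℝ)) with hρd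
  have hρ : 0 < ρ := by positivity
  have hρN : bN N * ρ ^ N = Real.exp (-j) := by
    rw [hρd, ← Real.rpow_natCast, ← Real.rpow_mul (by positivity), one_div_mul_cancel hN0.ne',
      Real.rpow_one]
    field_simp
  set R : ℝ := ρ * Real.exp ((j - i) / N) with hRd
  have hR : ρ ≤ R := by
    have : 1 ≤ Real.exp ((j - i) / N) := Real.one_le_exp (div_nonneg (by linarith) hN0.le)
    nlinarith
  have hRN : bN N * R ^ N = Real.exp (-i) := by
    rw [hRd, mul_pow, ← mul_assoc, hρN, ← Real.exp_nat_mul, ← Real.exp_add]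
    congr 1; field_simp; ring
  have hlog : Real.log (R / ρ) = (j - i) / N := by
    rw [hRd, mul_div_cancel_left₀ _ hρ.ne', Real.log_exp]
  have hm0 : volume F ≠ 0 := fun h => by
    rw [h] at ht
    exact absurd ht (not_le.2 (ENNReal.ofReal_pos.2 (Real.exp_pos _)))
  have hk := kernel_norm hN hρ hR hFm hGm (by rw [hρN]; exact ht) hFt
    (by rw [hRN]; exact (measure_mono fun y hy => hy.1).trans hsv)
  have hconst : N * bN N * Real.log (R / ρ) + bN N + 2 * (N + 1) * N * bN N =
      bN N * (j - i + cN N) := by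
    rw [hlog, cN]; field_simp; ring
  rw [hconst] at hk
  have hfm : Measurable fun y => ‖fderiv ℝ u y‖ₑ :=
    (hu.continuous_fderiv (by norm_num)).measurable.enorm
  have hKm : Measurable fun y => ∫⁻ x in F, ker N (y - x) :=
    Measurable.lintegral_prod_right' (f := fun p : EuclideanSpace ℝ (Fin N) ×
      EuclideanSpace ℝ (Fin N) => ker N (p.1 - p.2)) (measurable_ker.comp (by fun_prop))
  have hE : ∫⁻ y in G, ‖fderiv ℝ u y‖ₑ ^ (N:ℝ) = ENNReal.ofReal (en u G) := by
    rw [en, ofReal_integral_eq_lintegral_ofReal (en_integrable hN hu hc).integrableOn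
      (.of_forall fun y => by positivity)]
    refine lintegral_congr fun y => ?_
    rw [ENNReal.ofReal_pow (norm_nonneg _), ofReal_norm, ENNReal.rpow_natCast]
  have hEnn : 0 ≤ en u G := integral_nonneg fun y => by positivity
  have main : ENNReal.ofReal (t - s) * (N * ENNReal.ofReal (bN N)) * volume F ≤
      (ENNReal.ofReal (en u G) ^ (1 / (N:ℝ)) *
        ENNReal.ofReal (bN N * (j - i + cN N)) ^ (1 / qN N)) * volume F := by
    calc ENNReal.ofReal (t - s) * (N * ENNReal.ofReal (bN N)) * volume F
        = ∫⁻ x in F, ENNReal.ofReal (t - s) * (N * ENNReal.ofReal (bN N)) := by simp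
      _ ≤ ∫⁻ x in F, ∫⁻ y in G, ‖fderiv ℝ u y‖ₑ * ker N (y - x) := by
          refine setLIntegral_mono' hFm fun x hx => ?_
          rw [← vol_unit]
          exact potential_bound hN hu hc hs hst x hx
      _ = ∫⁻ y in G, ∫⁻ x in F, ‖fderiv ℝ u y‖ₑ * ker N (y - x) := by
          refine lintegral_lintegral_swap (Measurable.aemeasurable ?_)
          exact (hfm.comp measurable_snd).mul (measurable_ker.comp (by fun_prop))
      _ = ∫⁻ y in G, ‖fderiv ℝ u y‖ₑ * ∫⁻ x in F, ker N (y - x) := by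
          refine lintegral_congr fun y => ?_
          exact lintegral_const_mul' _ _ (by simp)
      _ ≤ (∫⁻ y in G, ‖fderiv ℝ u y‖ₑ ^ (N:ℝ)) ^ (1 / (N:ℝ)) *
          (∫⁻ y in G, (∫⁻ x in F, ker N (y - x)) ^ qN N) ^ (1 / qN N) :=
          ENNReal.lintegral_mul_le_Lp_mul_Lq _ (qN_conj hN) hfm.aemeasurable hKm.aemeasurable
      _ ≤ (ENNReal.ofReal (en u G)) ^ (1 / (N:ℝ)) *
          (volume F ^ qN N * ENNReal.ofReal (bN N * (j - i + cN N))) ^ (1 / qN N) := by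
          rw [hE]; gcongr
      _ = _ := by
          rw [ENNReal.mul_rpow_of_nonneg _ _ (by positivity), ← ENNReal.rpow_mul,
            mul_one_div_cancel (by linarith), ENNReal.rpow_one]
          ring
  rw [ENNReal.mul_le_mul_iff_left hm0 hFt, ← ENNReal.ofReal_natCast,
    ← ENNReal.ofReal_mul (by positivity), ← ENNReal.ofReal_mul (by linarith),
    ENNReal.ofReal_rpow_of_nonneg hEnn (by positivity),
    ENNReal.ofReal_rpow_of_nonneg (mul_nonneg hb.le (by linarith)) (by positivity),
    ← ENNReal.ofReal_mul (by positivity),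
    ENNReal.ofReal_le_ofReal_iff (by
      have : 0 ≤ j - i + cN N := by linarith
      positivity), ← alpha_rel hN, Real.mul_rpow hb.le (by linarith)] at main
  have hbp : 0 < bN N ^ (1 / qN N) := by positivity
  refine le_of_mul_le_mul_right ?_ hbp
  linarith


lemma holder_two (hN : 2 ≤ N) {x1 x2 e1 e2 : ℝ} (hx1 : 0 ≤ x1) (hx2 : 0 ≤ x2) (he1 : 0 ≤ e1)
    (he2 : 0 ≤ e2) :
    x1 ^ (1 / qN N) * e1 ^ (1 / (N:ℝ)) + x2 ^ (1 / qN N) * e2 ^ (1 / (N:ℝ)) ≤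
      (x1 + x2) ^ (1 / qN N) * (e1 + e2) ^ (1 / (N:ℝ)) := by
  have hq := qN_gt hN
  have hN0 : (0:ℝ) < N := by positivity
  have h := Real.inner_le_Lp_mul_Lq_of_nonneg (Finset.univ : Finset (Fin 2))
    (f := ![x1 ^ (1 / qN N), x2 ^ (1 / qN N)]) (g := ![e1 ^ (1 / (N:ℝ)), e2 ^ (1 / (N:ℝ))])
    (qN_conj hN).symm (by intro i _; fin_cases i <;> simp <;> positivity)
    (by intro i _; fin_cases i <;> simp <;> positivity)
  simp only [Fin.sum_univ_two, Matrix.cons_val_zero, Matrix.cons_val_one] at h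
  rwa [← Real.rpow_mul hx1, ← Real.rpow_mul hx2, ← Real.rpow_mul he1, ← Real.rpow_mul he2,
    one_div_mul_cancel (by linarith), one_div_mul_cancel hN0.ne', Real.rpow_one, Real.rpow_one,
    Real.rpow_one, Real.rpow_one] at h

lemma convex_two {q x y η : ℝ} (hq : 1 < q) (hx : 0 ≤ x) (hy : 0 ≤ y) (h0 : 0 < η) (h1 : η < 1) :
    (x + y) ^ q ≤ x ^ q * (1 - η) ^ (1 - q) + y ^ q * η ^ (1 - q) := by
  have h1' : 0 < 1 - η := by linarith
  have h := (convexOn_rpow hq.le).2 (show x / (1 - η) ∈ Ici (0:ℝ) from div_nonneg hx h1'.le)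
    (show y / η ∈ Ici (0:ℝ) from div_nonneg hy h0.le)
    h1'.le h0.le (sub_add_cancel 1 η)
  simp only [smul_eq_mul] at h
  rw [mul_div_cancel₀ _ h1'.ne', mul_div_cancel₀ _ h0.ne', Real.div_rpow hx h1'.le,
    Real.div_rpow hy h0.le] at h
  rw [Real.rpow_sub h1', Real.rpow_sub h0, Real.rpow_one, Real.rpow_one]
  calc _ ≤ _ := h
    _ = _ := by ring

set_option maxHeartbeats 1000000 in
/-- two indices where the deficit is small are close -/
lemma pair_close (hN : 2 ≤ N) {C i j φi φj a lam : ℝ} (hC : 0 < C) (hij : i < j)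
    (hφi : 0 ≤ φi) (hφj : 0 ≤ φj) (ha0 : 0 ≤ a) (ha1 : a ≤ 1) (hl : 0 ≤ lam)
    (h1 : φi ≤ (i + C) ^ (1 / qN N) * a ^ (1 / (N:ℝ)))
    (h2 : φj ≤ φi + (j - i + C) ^ (1 / qN N) * (1 - a) ^ (1 / (N:ℝ)))
    (h3 : i - lam ≤ φi ^ qN N) (h4 : j - lam ≤ φj ^ qN N)
    (hK : 2 ^ N * N * (C + 1) * (lam + 1) ≤ i) :
    j - i ≤ (C + 1) * (4 + 2 ^ (N + 1) * N) * (lam + 1) := by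
  have hq := qN_gt hN
  have hq2 := qN_le hN
  have hNr : (2:ℝ) ≤ N := by exact_mod_cast hN
  have hN0 : (0:ℝ) < N := by linarith
  have hqinv : 1 / qN N * qN N = 1 := one_div_mul_cancel (by linarith)
  have hqN : 1 / (N:ℝ) * qN N = 1 / ((N:ℝ) - 1) := by
    rw [← qN_sub_one hN, ← qN_div hN]; ring
  have hLle : lam + C ≤ (C + 1) * (lam + 1) := by nlinarith
  have hpow : (1:ℝ) ≤ 2 ^ N := one_le_pow₀ (by norm_num)
  have hi : lam + C ≤ i := by
    have : (1:ℝ) * ((C+1)*(lam+1)) ≤ 2 ^ N * N * ((C + 1) * (lam + 1)) := by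
      gcongr; nlinarith
    nlinarith
  set L := lam + C with hL
  have hLpos : 0 < L := by linarith
  set A := i + C with hA
  have hApos : 0 < A := by linarith
  set b := j - i + C with hb
  have hbpos : 0 < b := by linarith
  -- energy deficit
  have he : 1 - a ≤ ((N:ℝ) - 1) * L / A := by
    have e1 : φi ^ qN N ≤ A * a ^ (1 / ((N:ℝ) - 1)) := by
      calc φi ^ qN N ≤ (A ^ (1 / qN N) * a ^ (1 / (N:ℝ))) ^ qN N := by gcongr
        _ = _ := by
          rw [Real.mul_rpow (by positivity) (by positivity), ← Real.rpow_mul hApos.le, hqinv,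
            Real.rpow_one, ← Real.rpow_mul ha0, hqN]
    have e2 : 1 - L / A ≤ a ^ (1 / ((N:ℝ) - 1)) := by
      have : A - L ≤ A * a ^ (1 / ((N:ℝ) - 1)) := by
        refine le_trans ?_ (h3.trans e1); linarith
      have h : 1 - L / A = (A - L) / A := by field_simp
      rw [h, div_le_iff₀ hApos]; linarith
    have hLA : L / A ≤ 1 := by rw [div_le_one hApos]; linarith
    have e3 : (1 - L / A) ^ (N - 1) ≤ a := by
      calc (1 - L / A) ^ (N - 1) ≤ (a ^ (1 / ((N:ℝ) - 1))) ^ (N - 1) :=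
            pow_le_pow_left₀ (by linarith) e2 _
        _ = a := by
          rw [← Real.rpow_natCast, ← Real.rpow_mul ha0, cast_pred hN,
            one_div_mul_cancel (by linarith), Real.rpow_one]
    have e4 := one_add_mul_le_pow (a := -(L / A)) (by linarith) (N - 1)
    rw [cast_pred hN] at e4
    have e5 : (1 + -(L / A)) = 1 - L / A := by ring
    rw [e5] at e4
    have e6 : ((N:ℝ) - 1) * L / A = ((N:ℝ) - 1) * (L / A) := by ring
    rw [e6]; nlinarith
  set e0 := ((N:ℝ) - 1) * L / A with he0
  have he0pos : 0 < e0 := by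
    have : (0:ℝ) < N - 1 := by linarith
    positivity
  set η := 2 ^ (N - 1) * e0 with hη
  have hηpos : 0 < η := by positivity
  have h2N : (2:ℝ) ^ N = 2 * 2 ^ (N - 1) := by
    rw [← pow_succ']; congr 1; omega
  have hηA : η * A = 2 ^ (N - 1) * (((N:ℝ) - 1) * L) := by
    rw [hη, he0]; field_simp
  have hbig : 2 ^ N * (((N:ℝ) - 1) * L) ≤ A := by
    have : 2 ^ N * (((N:ℝ) - 1) * L) ≤ 2 ^ N * (N * ((C + 1) * (lam + 1))) := by
      gcongr; linarith
    nlinarith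
  have hηhalf : η ≤ 1 / 2 := by
    have : η * A ≤ 1 / 2 * A := by rw [hηA]; rw [h2N] at hbig; linarith
    exact le_of_mul_le_mul_right this hApos
  -- main estimate
  have m1 : φi ≤ A ^ (1 / qN N) := by
    refine h1.trans ?_
    have : a ^ (1 / (N:ℝ)) ≤ 1 := Real.rpow_le_one ha0 ha1 (by positivity)
    exact mul_le_of_le_one_right (by positivity) this
  have m2 : φj ^ qN N ≤ (A ^ (1 / qN N) + b ^ (1 / qN N) * (1 - a) ^ (1 / (N:ℝ))) ^ qN N := by
    gcongr
    exact h2.trans (by gcongr)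
  have h1a : 0 ≤ 1 - a := by linarith
  have m3 := convex_two hq (x := A ^ (1 / qN N)) (y := b ^ (1 / qN N) * (1 - a) ^ (1 / (N:ℝ)))
    (by positivity) (by positivity) hηpos (by linarith)
  rw [Real.mul_rpow (by positivity) (by positivity), ← Real.rpow_mul hApos.le,
    ← Real.rpow_mul hbpos.le, hqinv, Real.rpow_one, Real.rpow_one, ← Real.rpow_mul h1a, hqN] at m3
  have m4 : (1 - η) ^ (1 - qN N) ≤ 1 + 2 * η := by
    calc (1 - η) ^ (1 - qN N) ≤ (1 - η) ^ (-1 : ℝ) :=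
          Real.rpow_le_rpow_of_exponent_ge (by linarith) (by linarith) (by linarith)
      _ = (1 - η)⁻¹ := Real.rpow_neg_one _
      _ ≤ 1 + 2 * η := by
          rw [inv_le_iff_one_le_mul₀ (by linarith)]
          nlinarith
  have m5 : (1 - a) ^ (1 / ((N:ℝ) - 1)) * η ^ (1 - qN N) ≤ 1 / 2 := by
    have hx : (0:ℝ) < 1 / ((N:ℝ) - 1) := by apply div_pos one_pos; linarith
    have : (1:ℝ) - qN N = - (1 / ((N:ℝ) - 1)) := by rw [← qN_sub_one hN]; ring
    rw [this, Real.rpow_neg hηpos.le, ← div_eq_mul_inv, ← Real.div_rpow h1a hηpos.le]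
    have hle : (1 - a) / η ≤ ((1:ℝ)/2) ^ (N-1) := by
      rw [div_le_iff₀ hηpos, hη, ← mul_assoc, ← mul_pow]
      norm_num; linarith
    calc ((1 - a) / η) ^ (1 / ((N:ℝ) - 1)) ≤ (((1:ℝ)/2) ^ (N-1)) ^ (1 / ((N:ℝ) - 1)) := by
          gcongr
      _ = 1 / 2 := by
          rw [← Real.rpow_natCast, ← Real.rpow_mul (by norm_num), cast_pred hN,
            mul_one_div_cancel (by linarith), Real.rpow_one]
  have m6 : j - lam ≤ A * (1 + 2 * η) + b * (1 / 2) := by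
    calc j - lam ≤ _ := h4
      _ ≤ _ := m2
      _ ≤ _ := m3
      _ = A * (1 - η) ^ (1 - qN N) + b * ((1 - a) ^ (1 / ((N:ℝ) - 1)) * η ^ (1 - qN N)) := by ring
      _ ≤ _ := by gcongr
  have m7 : A * (1 + 2 * η) = A + 2 ^ N * (((N:ℝ) - 1) * L) := by
    rw [h2N]; linarith
  rw [m7] at m6
  have m8 : 2 ^ N * (((N:ℝ) - 1) * L) ≤ 2 ^ N * (N * ((C + 1) * (lam + 1))) := by
    gcongr; linarith
  have m9 : (2:ℝ) ^ (N+1) = 2 * 2 ^ N := by rw [pow_succ']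
  rw [m9]
  have m10 : lam + C + C ≤ 2 * ((C + 1) * (lam + 1)) := by nlinarith
  have m11 : b / 2 ≤ lam + C + C + 2 ^ N * (N * ((C + 1) * (lam + 1))) := by linarith
  have m12 : (C + 1) * (4 + 2 * 2 ^ N * N) * (lam + 1) =
    2 * (2 * ((C + 1) * (lam + 1))) + 2 * (2 ^ N * (N * ((C + 1) * (lam + 1)))) := by ring
  rw [m12]; linarith

lemma moser_discrete (hN : 2 ≤ N) {C : ℝ} (hC : 0 < C) : ∃ D : ℝ, ∀ φ a : ℕ → ℝ,
    (∀ k, 0 ≤ φ k) → (∀ k, 0 ≤ a k) → (∀ k, a k ≤ 1) →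
    (∀ k : ℕ, φ k ≤ ((k:ℝ) + C) ^ (1 / qN N) * a k ^ (1 / (N:ℝ))) →
    (∀ i j : ℕ, i < j → φ j ≤ φ i + ((j:ℝ) - i + C) ^ (1 / qN N) * (1 - a i) ^ (1 / (N:ℝ))) →
    ∀ M : ℕ, ∑ k ∈ Finset.range M, Real.exp (φ k ^ qN N - k) ≤ D := by
  have hq := qN_gt hN
  set K : ℝ := 2 ^ N * N * (C + 1) with hK
  set A : ℝ := (C + 1) * (4 + 2 ^ (N + 1) * N) with hA
  have hKpos : 0 < K := by positivity
  have hApos : 0 < A := by positivity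
  have hsummable : Summable fun n : ℕ => (K + A + 2) * ((n:ℝ) + 1) * Real.exp (-(n:ℝ)) := by
    have h1 := Real.summable_pow_mul_exp_neg_nat_mul 1 (r := 1) one_pos
    have h0 := Real.summable_pow_mul_exp_neg_nat_mul 0 (r := 1) one_pos
    refine ((h1.add h0).mul_left (K + A + 2)).congr fun n => ?_
    simp; ring
  refine ⟨Real.exp (C + 1) * ∑' n : ℕ, (K + A + 2) * ((n:ℝ) + 1) * Real.exp (-(n:ℝ)), ?_⟩
  intro φ a hφ ha0 ha1 H1 H2 M
  have hub : ∀ k : ℕ, φ k ^ qN N - k ≤ C := by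
    intro k
    have : φ k ≤ ((k:ℝ) + C) ^ (1 / qN N) := by
      refine (H1 k).trans ?_
      exact mul_le_of_le_one_right (by positivity)
        (Real.rpow_le_one (ha0 k) (ha1 k) (by positivity))
    have h2 : φ k ^ qN N ≤ (((k:ℝ) + C) ^ (1 / qN N)) ^ qN N := by
      have := hφ k
      gcongr
    rw [← Real.rpow_mul (by positivity), one_div_mul_cancel (by linarith), Real.rpow_one] at h2
    linarith
  -- counting
  set T : ℕ → Finset ℕ := fun n => (Finset.range M).filter fun k => (k:ℝ) - n ≤ φ k ^ qN N with hT
  have hcard : ∀ n : ℕ, ((T n).card : ℝ) ≤ (K + A + 2) * ((n:ℝ) + 1) := by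
    intro n
    set T' := (T n).filter fun k : ℕ => K * ((n:ℝ) + 1) ≤ k with hT'
    have hsub1 : T n ⊆ Finset.range (⌈K * ((n:ℝ) + 1)⌉₊) ∪ T' := by
      intro k hk
      by_cases h : K * ((n:ℝ) + 1) ≤ k
      · exact Finset.mem_union_right _ (Finset.mem_filter.2 ⟨hk, h⟩)
      · refine Finset.mem_union_left _ (Finset.mem_range.2 ?_)
        rw [Nat.lt_ceil]; exact not_le.1 h
    have hc' : (T'.card : ℝ) ≤ A * ((n:ℝ) + 1) + 1 := by
      rcases T'.eq_empty_or_nonempty with h | h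
      · rw [h]; simp; positivity
      · set i := T'.min' h with hi
        have hiT : i ∈ T' := T'.min'_mem h
        have hsub2 : T' ⊆ Finset.Icc i (i + ⌊A * ((n:ℝ) + 1)⌋₊) := by
          intro j hj
          have hij : i ≤ j := T'.min'_le j hj
          refine Finset.mem_Icc.2 ⟨hij, ?_⟩
          rcases hij.eq_or_lt with h | h
          · omega
          · have h5 := Finset.mem_filter.1 hiT
            have h6 := Finset.mem_filter.1 hj
            have h7 := (Finset.mem_filter.1 h5.1).2
            have h8 := (Finset.mem_filter.1 h6.1).2
            have := pair_close hN hC (i := i) (j := j) (lam := n) (by exact_mod_cast h)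
              (hφ i) (hφ j) (ha0 i) (ha1 i) (by positivity) (H1 i) (H2 i j h) h7 h8 h5.2
            have h9 : j - i ≤ ⌊A * ((n:ℝ) + 1)⌋₊ := by
              refine Nat.le_floor ?_
              rw [Nat.cast_sub hij]
              exact this
            omega
        have := Finset.card_le_card hsub2
        rw [Nat.card_Icc] at this
        have h10 : (⌊A * ((n:ℝ) + 1)⌋₊ : ℝ) ≤ A * ((n:ℝ) + 1) := Nat.floor_le (by positivity)
        have h11 : T'.card ≤ ⌊A * ((n:ℝ) + 1)⌋₊ + 1 := by omega
        have h12 : (T'.card : ℝ) ≤ (⌊A * ((n:ℝ) + 1)⌋₊ : ℝ) + 1 := by exact_mod_cast h11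
        linarith
    have h1 := (Finset.card_le_card hsub1).trans (Finset.card_union_le _ _)
    rw [Finset.card_range] at h1
    have h2 : ((T n).card : ℝ) ≤ (⌈K * ((n:ℝ) + 1)⌉₊ : ℝ) + T'.card := by exact_mod_cast h1
    have h3 : (⌈K * ((n:ℝ) + 1)⌉₊ : ℝ) < K * ((n:ℝ) + 1) + 1 := Nat.ceil_lt_add_one (by positivity)
    have hn : (0:ℝ) ≤ n := by positivity
    nlinarith
  -- pointwise bound
  set nk : ℕ → ℕ := fun k => ⌈(k:ℝ) - φ k ^ qN N⌉₊ with hnk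
  have hpt : ∀ k, Real.exp (φ k ^ qN N - k) ≤ Real.exp (C + 1) * Real.exp (-(nk k : ℝ)) := by
    intro k
    rw [← Real.exp_add]
    apply Real.exp_le_exp.2
    rcases le_total 0 ((k:ℝ) - φ k ^ qN N) with h | h
    · have := Nat.ceil_lt_add_one h
      simp only [hnk]; linarith
    · have : nk k = 0 := Nat.ceil_eq_zero.2 h
      rw [this]; have := hub k; simp; linarith
  set P := (Finset.range M).sup nk + 1 with hP
  have hmaps : ∀ k ∈ Finset.range M, nk k ∈ Finset.range P := by
    intro k hk
    have := Finset.le_sup (f := nk) hk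
    exact Finset.mem_range.2 (by omega)
  calc ∑ k ∈ Finset.range M, Real.exp (φ k ^ qN N - k)
      ≤ ∑ k ∈ Finset.range M, Real.exp (C + 1) * Real.exp (-(nk k : ℝ)) :=
        Finset.sum_le_sum fun k _ => hpt k
    _ = Real.exp (C + 1) * ∑ k ∈ Finset.range M, Real.exp (-(nk k : ℝ)) := by
        rw [Finset.mul_sum]
    _ = Real.exp (C + 1) * ∑ n ∈ Finset.range P, ∑ k ∈ Finset.range M with nk k = n,
          Real.exp (-(nk k : ℝ)) := by
        rw [Finset.sum_fiberwise_of_maps_to hmaps]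
    _ ≤ Real.exp (C + 1) * ∑ n ∈ Finset.range P, (K + A + 2) * ((n:ℝ) + 1) * Real.exp (-(n:ℝ)) := by
        gcongr with n hn
        have : ∀ k ∈ (Finset.range M).filter (fun k => nk k = n),
            Real.exp (-(nk k : ℝ)) = Real.exp (-(n:ℝ)) := by
          intro k hk; rw [(Finset.mem_filter.1 hk).2]
        rw [Finset.sum_congr rfl this, Finset.sum_const, nsmul_eq_mul]
        gcongr
        refine le_trans ?_ (hcard n)
        norm_cast
        refine Finset.card_le_card ?_
        intro k hk
        have hk' := Finset.mem_filter.1 hk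
        refine Finset.mem_filter.2 ⟨hk'.1, ?_⟩
        have := Nat.le_ceil ((k:ℝ) - φ k ^ qN N)
        have h2 : (nk k : ℝ) = n := by rw [hk'.2]
        simp only [hnk] at h2
        linarith
    _ ≤ _ := by
        gcongr
        exact hsummable.sum_le_tsum _ fun n _ => by positivity


lemma Phi_eq (hN : 2 ≤ N) (t : ℝ) : PhiMT N t =
    Real.exp (alphaMT N * |t| ^ qN N) -
      ∑ j ∈ Finset.range (N - 1), (alphaMT N * |t| ^ qN N) ^ j / (Nat.factorial j : ℝ) := by
  unfold PhiMT
  congr 1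
  refine Finset.sum_congr rfl fun j _ => ?_
  rw [mul_pow, ← Real.rpow_natCast (|t| ^ qN N), ← Real.rpow_mul (abs_nonneg t)]
  congr 3
  unfold qN; ring

lemma x_pow (hN : 2 ≤ N) (t : ℝ) :
    (alphaMT N * |t| ^ qN N) ^ (N - 1) = alphaMT N ^ (N - 1) * |t| ^ N := by
  have hNr : (2:ℝ) ≤ N := by exact_mod_cast hN
  rw [mul_pow, ← Real.rpow_natCast (|t| ^ qN N), ← Real.rpow_mul (abs_nonneg t), cast_pred hN,
    ← Real.rpow_natCast (|t|) N]
  congr 2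
  have : (N:ℝ) - 1 ≠ 0 := by linarith
  unfold qN; field_simp

lemma x_nonneg (hN : 2 ≤ N) (t : ℝ) : 0 ≤ alphaMT N * |t| ^ qN N := by
  have := alpha_pos hN
  positivity

lemma Phi_lower (hN : 2 ≤ N) (t : ℝ) :
    alphaMT N ^ (N - 1) / (Nat.factorial (N-1) : ℝ) * |t| ^ N ≤ PhiMT N t := by
  rw [Phi_eq hN]
  have h := Real.sum_le_exp_of_nonneg (x_nonneg hN t) (N - 1 + 1)
  rw [Finset.sum_range_succ, x_pow hN] at h
  have e : alphaMT N ^ (N - 1) / (Nat.factorial (N-1) : ℝ) * |t| ^ N =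
    alphaMT N ^ (N - 1) * |t| ^ N / (Nat.factorial (N-1) : ℝ) := by ring
  rw [e]
  linarith

lemma Phi_nonneg (hN : 2 ≤ N) (t : ℝ) : 0 ≤ PhiMT N t := by
  refine le_trans ?_ (Phi_lower hN t)
  have := alpha_pos hN
  positivity

lemma Phi_le_exp (hN : 2 ≤ N) (t : ℝ) : PhiMT N t ≤ Real.exp (alphaMT N * |t| ^ qN N) := by
  rw [Phi_eq hN]
  have := x_nonneg hN t
  have : 0 ≤ ∑ j ∈ Finset.range (N - 1), (alphaMT N * |t| ^ qN N) ^ j / (Nat.factorial j : ℝ) :=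
    Finset.sum_nonneg fun j _ => by positivity
  linarith

lemma Phi_upper (hN : 2 ≤ N) (t : ℝ) :
    PhiMT N t ≤ alphaMT N ^ (N - 1) * Real.exp (alphaMT N * |t| ^ qN N) * |t| ^ N := by
  have h := Complex.norm_exp_sub_sum_le_norm_mul_exp ((alphaMT N * |t| ^ qN N : ℝ) : ℂ) (N - 1)
  have h2 : Complex.exp ((alphaMT N * |t| ^ qN N : ℝ) : ℂ) - ∑ m ∈ Finset.range (N-1),
      ((alphaMT N * |t| ^ qN N : ℝ) : ℂ) ^ m / (Nat.factorial m : ℂ) = ((PhiMT N t : ℝ) : ℂ) := by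
    rw [Phi_eq hN]; push_cast; rfl
  rw [h2, Complex.norm_real, Complex.norm_real, Real.norm_eq_abs, Real.norm_eq_abs,
    abs_of_nonneg (x_nonneg hN t), x_pow hN] at h
  refine (le_abs_self _).trans (h.trans_eq ?_)
  ring

lemma Phi_continuous (hN : 2 ≤ N) : Continuous (PhiMT N) := by
  have hq := qN_gt hN
  have : PhiMT N = fun t => Real.exp (alphaMT N * |t| ^ qN N) -
      ∑ j ∈ Finset.range (N - 1), (alphaMT N * |t| ^ qN N) ^ j / (Nat.factorial j : ℝ) := by
    ext t; exact Phi_eq hN t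
  rw [this]
  have h1 : Continuous fun t : ℝ => |t| ^ qN N :=
    continuous_abs.rpow_const fun t => Or.inr (by linarith)
  fun_prop

lemma Phi_zero (hN : 2 ≤ N) : PhiMT N 0 = 0 := by
  refine le_antisymm ?_ (Phi_nonneg hN 0)
  refine (Phi_upper hN 0).trans_eq ?_
  rw [abs_zero, zero_pow (by omega), mul_zero]

/-! ### level heights -/

/-- level height -/
noncomputable def lev (u : EuclideanSpace ℝ (Fin N) → ℝ) (c : ℝ) : ℝ :=
  sInf {s : ℝ | 0 ≤ s ∧ volume {y | s < |u y|} ≤ ENNReal.ofReal c}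

section levels

variable {u : EuclideanSpace ℝ (Fin N) → ℝ}

lemma lev_nonempty (hu : Continuous u) (hc : HasCompactSupport u) (c : ℝ) :
    {s : ℝ | 0 ≤ s ∧ volume {y | s < |u y|} ≤ ENNReal.ofReal c}.Nonempty := by
  obtain ⟨B, hB⟩ := hc.exists_bound_of_continuous hu
  refine ⟨|B|, abs_nonneg _, ?_⟩
  have : {y | |B| < |u y|} = ∅ := by
    ext y
    simp only [mem_ofPred_eq, mem_empty_iff_false, iff_false, not_lt]
    exact (hB y).trans (le_abs_self B)
  rw [this]; simp

lemma lev_bdd (c : ℝ) :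
    BddBelow {s : ℝ | 0 ≤ s ∧ volume {y | s < |u y|} ≤ ENNReal.ofReal c} := ⟨0, fun _ h => h.1⟩

lemma lev_nonneg (c : ℝ) : 0 ≤ lev u c := Real.sInf_nonneg fun _ h => h.1

lemma lev_mono (hu : Continuous u) (hc : HasCompactSupport u) {c d : ℝ} (h : c ≤ d) :
    lev u d ≤ lev u c :=
  csInf_le_csInf (lev_bdd d) (lev_nonempty hu hc c)
    fun _ hs => ⟨hs.1, hs.2.trans (ENNReal.ofReal_le_ofReal h)⟩

lemma lev_vol_lt (hu : Continuous u) (hc : HasCompactSupport u) (c : ℝ) :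
    volume {y | lev u c < |u y|} ≤ ENNReal.ofReal c := by
  have he : {y | lev u c < |u y|} = ⋃ n : ℕ, {y | lev u c + 1 / ((n:ℝ) + 1) < |u y|} := by
    ext y
    simp only [mem_ofPred_eq, mem_iUnion]
    constructor
    · intro h
      obtain ⟨n, hn⟩ := exists_nat_one_div_lt (sub_pos.2 h)
      exact ⟨n, by linarith⟩
    · rintro ⟨n, hn⟩
      have : (0:ℝ) < 1 / ((n:ℝ) + 1) := by positivity
      linarith
  have hmono : Monotone fun n : ℕ => {y | lev u c + 1 / ((n:ℝ) + 1) < |u y|} := by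
    intro m n hmn y hy
    have hy' : lev u c + 1 / ((m:ℝ) + 1) < |u y| := hy
    have : 1 / ((n:ℝ) + 1) ≤ 1 / ((m:ℝ) + 1) := Nat.one_div_le_one_div hmn
    show lev u c + 1 / ((n:ℝ) + 1) < |u y|
    linarith
  rw [he, hmono.measure_iUnion]
  refine iSup_le fun n => ?_
  have hlt : lev u c < lev u c + 1 / ((n:ℝ) + 1) := by
    have : (0:ℝ) < 1 / ((n:ℝ) + 1) := by positivity
    linarith
  obtain ⟨s, hs, hsl⟩ := exists_lt_of_csInf_lt (lev_nonempty hu hc c) hlt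
  exact (measure_mono fun y (hy : _ < _) => hsl.trans hy).trans hs.2

lemma lev_vol_ge (hu : Continuous u) (hc : HasCompactSupport u) (c : ℝ) (hpos : 0 < lev u c) :
    ENNReal.ofReal c ≤ volume {y | lev u c ≤ |u y|} := by
  have hlow : ∀ s, 0 ≤ s → s < lev u c → ENNReal.ofReal c ≤ volume {y | s < |u y|} := by
    intro s h0 hs
    by_contra h
    have : s ∈ {s : ℝ | 0 ≤ s ∧ volume {y | s < |u y|} ≤ ENNReal.ofReal c} :=
      ⟨h0, (not_le.1 h).le⟩
    exact absurd (csInf_le (lev_bdd c) this) (not_le.2 hs)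
  set l := lev u c with hl
  have he : {y | l ≤ |u y|} = ⋂ n : ℕ, {y | l - l * (1 / ((n:ℝ) + 1)) < |u y|} := by
    ext y
    simp only [mem_ofPred_eq, mem_iInter]
    constructor
    · intro h n
      have : (0:ℝ) < l * (1 / ((n:ℝ) + 1)) := by positivity
      linarith
    · intro h
      by_contra h'
      have h' := not_le.1 h'
      obtain ⟨n, hn⟩ := exists_nat_one_div_lt (div_pos (sub_pos.2 h') hpos)
      rw [lt_div_iff₀ hpos] at hn
      have := h n
      linarith
  have hanti : Antitone fun n : ℕ => {y | l - l * (1 / ((n:ℝ) + 1)) < |u y|} := by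
    intro m n hmn y hy
    have hy' : l - l * (1 / ((n:ℝ) + 1)) < |u y| := hy
    have : 1 / ((n:ℝ) + 1) ≤ 1 / ((m:ℝ) + 1) := Nat.one_div_le_one_div hmn
    have := mul_le_mul_of_nonneg_left this hpos.le
    show l - l * (1 / ((m:ℝ) + 1)) < |u y|
    linarith
  have hmabs : Measurable fun y => |u y| := hu.measurable.norm
  rw [he, hanti.measure_iInter (fun n =>
    (measurableSet_lt measurable_const hmabs).nullMeasurableSet)]
  · refine le_iInf fun n => hlow _ ?_ ?_
    · have : 1 / ((n:ℝ) + 1) ≤ 1 := by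
        rw [div_le_one (by positivity)]; linarith [Nat.cast_nonneg (α := ℝ) n]
      have := mul_le_mul_of_nonneg_left this hpos.le
      linarith
    · have : (0:ℝ) < l * (1 / ((n:ℝ) + 1)) := by positivity
      linarith
  · refine ⟨0, ((measure_mono ?_).trans_lt (vol_level_lt_top hc)).ne⟩
    intro y hy h0
    have hy' : l - l * (1 / (((0:ℕ):ℝ) + 1)) < |u y| := hy
    rw [h0] at hy'
    simp at hy'

end levels

/-! ### cut-off -/

/-- even smooth cut-off -/
noncomputable def chi (x : ℝ) : ℝ := Real.smoothTransition (x ^ 2)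

lemma chi_contDiff : ContDiff ℝ (⊤ : ℕ∞) chi :=
  Real.smoothTransition.contDiff.comp (contDiff_id.pow 2)

lemma chi_one {x : ℝ} (hx : 1 ≤ |x|) : chi x = 1 :=
  Real.smoothTransition.one_of_one_le (by rw [← sq_abs]; nlinarith)

lemma chi_zero : chi 0 = 0 := Real.smoothTransition.zero_of_nonpos (by simp)

lemma chi_deriv {x : ℝ} (hx : 1 < |x|) : deriv chi x = 0 := by
  have : chi =ᶠ[nhds x] fun _ => 1 := by
    have : IsOpen {y : ℝ | 1 < |y|} := isOpen_lt continuous_const continuous_abs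
    filter_upwards [this.mem_nhds hx] with y hy using chi_one (le_of_lt hy)
  rw [this.deriv_eq]; simp

lemma chi_bound : ∃ M : ℝ, 0 < M ∧ ∀ x, |deriv chi x| ≤ M := by
  have hcont : Continuous (deriv chi) := chi_contDiff.continuous_deriv (by simp)
  obtain ⟨M, hM⟩ := (isCompact_Icc (a := (-1:ℝ)) (b := 1)).exists_bound_of_continuousOn
    hcont.continuousOn
  refine ⟨|M| + 1, by positivity, fun x => ?_⟩
  rcases le_or_gt |x| 1 with h | h
  · have := hM x (abs_le.1 h)
    rw [Real.norm_eq_abs] at this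
    linarith [le_abs_self M]
  · rw [chi_deriv h, abs_zero]; positivity

lemma setInt_eq {Ω : Set (EuclideanSpace ℝ (Fin N))} {u : EuclideanSpace ℝ (Fin N) → ℝ}
    (hs : tsupport u ⊆ Ω) (hN : 2 ≤ N) :
    ∫ x in Ω, ‖fderiv ℝ u x‖ ^ N = ∫ x, ‖fderiv ℝ u x‖ ^ N := by
  refine setIntegral_eq_integral_of_forall_compl_eq_zero fun x hx => ?_
  have : fderiv ℝ u x = 0 := by
    by_contra h
    exact hx (hs (support_fderiv_subset ℝ h))
  rw [this, norm_zero, zero_pow (by omega)]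

lemma setInt_eq' {Ω : Set (EuclideanSpace ℝ (Fin N))} {u : EuclideanSpace ℝ (Fin N) → ℝ}
    (hs : tsupport u ⊆ Ω) (g : ℝ → ℝ) (hg : g 0 = 0) :
    ∫ x in Ω, g (u x) = ∫ x, g (u x) := by
  refine setIntegral_eq_integral_of_forall_compl_eq_zero fun x hx => ?_
  rw [image_eq_zero_of_notMem_tsupport (fun h => hx (hs h)), hg]

lemma integrable_comp {u : EuclideanSpace ℝ (Fin N) → ℝ} (hu : Continuous u)
    (hc : HasCompactSupport u) (g : ℝ → ℝ) (hgc : Continuous g) (hg : g 0 = 0) :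
    Integrable fun x => g (u x) :=
  (hgc.comp hu).integrable_of_hasCompactSupport (hc.comp_left hg)

lemma trunc_poincare (hN : 2 ≤ N) : ∃ M : ℝ, 0 < M ∧ ∀ (Ω : Set (EuclideanSpace ℝ (Fin N)))
    (lam : ℝ), 0 < lam → (∀ u : EuclideanSpace ℝ (Fin N) → ℝ, IsTest Ω u →
        lam * ∫ x in Ω, |u x| ^ N ≤ ∫ x in Ω, ‖fderiv ℝ u x‖ ^ N) →
    ∀ u : EuclideanSpace ℝ (Fin N) → ℝ, IsTest Ω u → ∀ t, 0 < t →
      lam * (t ^ N * volume.real {y | t ≤ |u y|}) ≤ M ^ N * en u {y | |u y| ≤ t} := by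
  obtain ⟨M, hM, hMb⟩ := chi_bound
  refine ⟨M, hM, fun Ω lam hlam hP u hu t ht => ?_⟩
  obtain ⟨hu1, hu2, hu3⟩ := hu
  have hN0 : N ≠ 0 := by omega
  have hmabs : Measurable fun y => |u y| := hu1.continuous.measurable.norm
  set g : ℝ → ℝ := fun s => t * chi (s / t) with hg
  have hg0 : g 0 = 0 := by simp [hg, chi_zero]
  have hgs : ContDiff ℝ (⊤ : ℕ∞) g := contDiff_const.mul (chi_contDiff.comp (contDiff_id.div_const t))
  have hgd : ∀ s, HasDerivAt g (deriv chi (s / t)) s := by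
    intro s
    have h1 : HasDerivAt chi (deriv chi (s / t)) (s / t) :=
      ((chi_contDiff.differentiable (by simp)) _).hasDerivAt
    have h2 : HasDerivAt (fun s : ℝ => s / t) (1 / t) s := (hasDerivAt_id s).div_const t
    have := (h1.comp s h2).const_mul t
    have e : t * (deriv chi (s / t) * (1 / t)) = deriv chi (s / t) := by
      have := ht.ne'
      field_simp
    rw [e] at this
    exact this
  set v : EuclideanSpace ℝ (Fin N) → ℝ := fun y => g (u y) with hv
  have hvs : tsupport v ⊆ tsupport u :=
    closure_mono fun y hy h0 => hy (by show g (u y) = 0; rw [h0, hg0])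
  have hvt : IsTest Ω v := ⟨hgs.comp hu1, hu2.comp_left hg0, hvs.trans hu3⟩
  have hfd : ∀ y, fderiv ℝ v y = deriv chi (u y / t) • fderiv ℝ u y := by
    intro y
    have h1 : HasFDerivAt u (fderiv ℝ u y) y :=
      ((hu1.differentiable (by simp)) y).hasFDerivAt
    exact ((hgd (u y)).comp_hasFDerivAt y h1).fderiv
  have h := hP v hvt
  have hu1' : ContDiff ℝ 1 u := hu1.of_le (by norm_cast)
  have hintg := en_integrable hN hu1' hu2
  have hR : ∫ x in Ω, ‖fderiv ℝ v x‖ ^ N ≤ M ^ N * en u {y | |u y| ≤ t} := by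
    have hvt' := hvt.2.2
    rw [setInt_eq hvt' hN, en, ← integral_indicator (measurableSet_le hmabs measurable_const),
      ← integral_const_mul]
    refine integral_mono_of_nonneg (.of_forall fun y => by positivity) ?_ (.of_forall fun y => ?_)
    · exact (hintg.indicator (measurableSet_le hmabs measurable_const)).const_mul _
    · simp only [hfd]
      by_cases hy : |u y| ≤ t
      · rw [indicator_of_mem (show y ∈ {y | |u y| ≤ t} from hy), norm_smul, mul_pow]
        gcongr
        exact hMb _
      · rw [indicator_of_notMem (show y ∉ {y | |u y| ≤ t} from hy), chi_deriv]
        · simp [hN0]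
        · rw [abs_div, abs_of_pos ht, lt_div_iff₀ ht]; linarith
  have hLft : t ^ N * volume.real {y | t ≤ |u y|} ≤ ∫ x in Ω, |v x| ^ N := by
    have hgN : (fun s => |g s| ^ N) 0 = 0 := by simp [hg0, hN0]
    have e1 : ∫ x in Ω, |v x| ^ N = ∫ x, |v x| ^ N := setInt_eq' hu3 (fun s => |g s| ^ N) hgN
    have hi : Integrable fun x => |v x| ^ N :=
      integrable_comp hu1.continuous hu2 (fun s => |g s| ^ N)
        ((continuous_abs.comp hgs.continuous).pow N) hgN
    have hms : MeasurableSet {y | t ≤ |u y|} := measurableSet_le measurable_const hmabs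
    have hfin : volume {y | t ≤ |u y|} ≠ ⊤ := by
      refine ((measure_mono ?_).trans_lt (vol_level_lt_top hu2)).ne
      intro y (hy : t ≤ |u y|) h0
      rw [h0, abs_zero] at hy
      linarith
    rw [e1]
    calc t ^ N * volume.real {y | t ≤ |u y|} = ∫ x in {y | t ≤ |u y|}, t ^ N := by
          rw [setIntegral_const, smul_eq_mul, mul_comm]
      _ = ∫ x in {y | t ≤ |u y|}, |v x| ^ N := by
          refine setIntegral_congr_fun hms fun y (hy : t ≤ |u y|) => ?_
          simp only [hv, hg]
          rw [chi_one (by rw [abs_div, abs_of_pos ht, le_div_iff₀ ht]; linarith), mul_one,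
            abs_of_pos ht]
      _ ≤ ∫ x, |v x| ^ N := setIntegral_le_integral hi (.of_forall fun y => by positivity)
  calc _ ≤ lam * ∫ x in Ω, |v x| ^ N := by gcongr
    _ ≤ _ := h
    _ ≤ _ := hR


lemma IsTest_smul {Ω : Set (EuclideanSpace ℝ (Fin N))} {u : EuclideanSpace ℝ (Fin N) → ℝ}
    (hu : IsTest Ω u) (c : ℝ) : IsTest Ω (fun y => c * u y) := by
  obtain ⟨h1, h2, h3⟩ := hu
  refine ⟨contDiff_const.mul h1, h2.comp_left (g := fun s => c * s) (by simp), ?_⟩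
  have h4 : Function.support (fun y => c * u y) ⊆ Function.support u :=
    fun y hy h0 => hy (by simp [h0])
  exact (closure_mono h4).trans h3

lemma forward (hN : 2 ≤ N) (Ω : Set (EuclideanSpace ℝ (Fin N)))
    (hB : BddAbove {r : ℝ | ∃ u : EuclideanSpace ℝ (Fin N) → ℝ, IsTest Ω u ∧
        (∫ x in Ω, ‖fderiv ℝ u x‖ ^ N) ≤ 1 ∧
        r = ∫ x in Ω, PhiMT N (u x)}) :
    ∃ lam : ℝ, 0 < lam ∧ ∀ u : EuclideanSpace ℝ (Fin N) → ℝ, IsTest Ω u →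
        lam * ∫ x in Ω, |u x| ^ N ≤ ∫ x in Ω, ‖fderiv ℝ u x‖ ^ N := by
  obtain ⟨S, hS⟩ := hB
  have hα := alpha_pos hN
  have hN0 : N ≠ 0 := by omega
  set κ : ℝ := alphaMT N ^ (N - 1) / (Nat.factorial (N-1) : ℝ) with hκd
  have hκ : 0 < κ := by positivity
  set T : ℝ := |S| / κ + 1 with hT
  have hTpos : 0 < T := by positivity
  have h1 : ∀ u : EuclideanSpace ℝ (Fin N) → ℝ, IsTest Ω u →
      (∫ x in Ω, ‖fderiv ℝ u x‖ ^ N) ≤ 1 → ∫ x in Ω, |u x| ^ N ≤ T := by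
    intro u hu hg
    have hs : ∫ x in Ω, PhiMT N (u x) ≤ S := hS ⟨u, hu, hg, rfl⟩
    have hle : κ * ∫ x in Ω, |u x| ^ N ≤ ∫ x in Ω, PhiMT N (u x) := by
      rw [← integral_const_mul]
      refine integral_mono_of_nonneg (.of_forall fun y => by positivity) ?_
        (.of_forall fun y => Phi_lower hN _)
      exact (integrable_comp hu.1.continuous hu.2.1 (PhiMT N) (Phi_continuous hN)
        (Phi_zero hN)).integrableOn
    have : ∫ x in Ω, |u x| ^ N ≤ |S| / κ := by
      rw [le_div_iff₀ hκ, mul_comm]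
      exact hle.trans (hs.trans (le_abs_self S))
    linarith
  refine ⟨1 / T, by positivity, fun u hu => ?_⟩
  set G := ∫ x in Ω, ‖fderiv ℝ u x‖ ^ N with hG
  set P := ∫ x in Ω, |u x| ^ N with hP
  have hG0 : 0 ≤ G := integral_nonneg fun y => by positivity
  have hP0 : 0 ≤ P := integral_nonneg fun y => by positivity
  have key : ∀ d : ℝ, 0 < d → d * G ≤ 1 → d * P ≤ T := by
    intro d hd hdG
    set c : ℝ := d ^ (1 / (N:ℝ)) with hc
    have hc0 : 0 < c := by positivity
    have hcN : c ^ N = d := by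
      rw [hc, one_div]; exact Real.rpow_inv_natCast_pow hd.le hN0
    have e1 : ∫ x in Ω, ‖fderiv ℝ (fun y => c * u y) x‖ ^ N = d * G := by
      rw [hG, ← integral_const_mul]
      congr 1
      ext x
      rw [fderiv_const_mul ((hu.1.differentiable (by simp)) x), norm_smul, mul_pow,
        Real.norm_of_nonneg hc0.le, hcN]
    have e2 : ∫ x in Ω, |c * u x| ^ N = d * P := by
      rw [hP, ← integral_const_mul]
      congr 1
      ext x
      rw [abs_mul, mul_pow, abs_of_pos hc0, hcN]
    rw [← e2]
    exact h1 _ (IsTest_smul hu c) (by rw [e1]; exact hdG)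
  rw [one_div, inv_mul_le_iff₀ hTpos]
  rcases hG0.eq_or_lt with h | h
  · rw [← h, mul_zero]
    by_contra hcon
    have hPp : 0 < P := not_le.1 hcon
    have := key ((T + 1) / P) (by positivity) (by rw [← h]; simp)
    rw [div_mul_cancel₀ _ hPp.ne'] at this
    linarith
  · have := key (1 / G) (by positivity) (by rw [one_div, inv_mul_cancel₀ h.ne'])
    rw [one_div, inv_mul_le_iff₀ h] at this
    linarith

lemma exp_level_bound (hN : 2 ≤ N) (Ω : Set (EuclideanSpace ℝ (Fin N))) {lam : ℝ} (hlam : 0 < lam)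
    (hP : ∀ u : EuclideanSpace ℝ (Fin N) → ℝ, IsTest Ω u →
        lam * ∫ x in Ω, |u x| ^ N ≤ ∫ x in Ω, ‖fderiv ℝ u x‖ ^ N) :
    ∃ C D : ℝ, ∀ u : EuclideanSpace ℝ (Fin N) → ℝ, IsTest Ω u →
      (∫ x in Ω, ‖fderiv ℝ u x‖ ^ N) ≤ 1 →
      (alphaMT N * lev u (Real.exp (-((0:ℕ):ℝ))) ^ qN N ≤ C) ∧
      ∀ M : ℕ, ∑ k ∈ Finset.range M,
        Real.exp (alphaMT N * lev u (Real.exp (-(k:ℝ))) ^ qN N - k) ≤ D := by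
  have hα := alpha_pos hN
  have hq := qN_gt hN
  have hN0 : N ≠ 0 := by omega
  have hNr : (0:ℝ) < N := by positivity
  have hq0 : 0 < qN N := by linarith
  obtain ⟨M, hM, hMP⟩ := trunc_poincare hN
  set β : ℝ := alphaMT N ^ (1 / qN N) with hβ
  have hβ0 : 0 < β := by positivity
  set X : ℝ := β * (M ^ N / lam) ^ (1 / (N:ℝ)) with hX
  have hX0 : 0 < X := by positivity
  set C0 : ℝ := X ^ qN N with hC0
  have hC00 : 0 < C0 := by positivity
  have hcN := cN_pos (N := N)
  set C : ℝ := C0 + cN N with hC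
  have hCpos : 0 < C := by positivity
  obtain ⟨D, hD⟩ := moser_discrete hN hCpos
  refine ⟨C, D, fun u hu hg => ?_⟩
  obtain ⟨hu1, hu2, hu3⟩ := id hu
  have hu1' : ContDiff ℝ 1 u := hu1.of_le (by norm_cast)
  have hcont := hu1.continuous
  have hintg := en_integrable hN hu1' hu2
  have hmabs : Measurable fun y => |u y| := hcont.measurable.norm
  rw [setInt_eq hu3 hN] at hg
  set s : ℕ → ℝ := fun k => lev u (Real.exp (-(k:ℝ))) with hs
  set φ : ℕ → ℝ := fun k => β * s k with hφ
  set a : ℕ → ℝ := fun k => en u {y | |u y| ≤ s k} with ha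
  have hs0 : ∀ k, 0 ≤ s k := fun k => lev_nonneg _
  have hsm : Monotone s := fun i j hij => lev_mono hcont hu2 (by
    apply Real.exp_le_exp.2
    have : (i:ℝ) ≤ j := by exact_mod_cast hij
    linarith)
  have hφ0 : ∀ k, 0 ≤ φ k := fun k => mul_nonneg hβ0.le (hs0 k)
  have hennn : ∀ S, 0 ≤ en u S := fun S => integral_nonneg fun y => by positivity
  have hen1 : ∀ S, en u S ≤ 1 := fun S =>
    (setIntegral_le_integral hintg (.of_forall fun y => by positivity)).trans hg
  have hφq : ∀ k, φ k ^ qN N = alphaMT N * s k ^ qN N := by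
    intro k
    simp only [hφ]
    rw [Real.mul_rpow hβ0.le (hs0 k), hβ, ← Real.rpow_mul hα.le, one_div_mul_cancel hq0.ne',
      Real.rpow_one]
  have hdis : ∀ i j, a i + en u {y | s i < |u y| ∧ |u y| < s j} =
      en u ({y | |u y| ≤ s i} ∪ {y | s i < |u y| ∧ |u y| < s j}) := by
    intro i j
    simp only [ha, en]
    rw [setIntegral_union _ _ hintg.integrableOn hintg.integrableOn]
    · rw [Set.disjoint_left]
      rintro y hy ⟨h1, h2⟩
      have hy' : |u y| ≤ s i := hy
      linarith
    · exact (measurableSet_lt measurable_const hmabs).inter (measurableSet_lt hmabs measurable_const)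
  have hdis1 : ∀ i j, en u {y | s i < |u y| ∧ |u y| < s j} ≤ 1 - a i := by
    intro i j
    have := hen1 ({y | |u y| ≤ s i} ∪ {y | s i < |u y| ∧ |u y| < s j})
    rw [← hdis] at this
    linarith
  have hdis2 : ∀ i j, i ≤ j → a i + en u {y | s i < |u y| ∧ |u y| < s j} ≤ a j := by
    intro i j hij
    rw [hdis]
    simp only [ha]
    refine setIntegral_mono_set hintg.integrableOn (.of_forall fun y => by positivity)
      (LE.le.eventuallyLE ?_)
    rintro y (hy | ⟨h1, h2⟩)
    · exact le_trans (show |u y| ≤ s i from hy) (hsm hij)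
    · exact h2.le
  have hlev : ∀ i j, i < j → φ j - φ i ≤
      ((j:ℝ) - i + cN N) ^ (1 / qN N) * en u {y | s i < |u y| ∧ |u y| < s j} ^ (1 / (N:ℝ)) := by
    intro i j hij
    have hij' : (i:ℝ) ≤ j := by exact_mod_cast hij.le
    rcases (hsm hij.le).eq_or_lt with h | h
    · simp only [hφ]
      rw [h, sub_self]
      have := hennn {y | s j < |u y| ∧ |u y| < s j}
      have h2 : 0 ≤ (j:ℝ) - i + cN N := by linarith
      positivity
    · have := level_ineq hN hu1' hu2 (hs0 i) h hij'
        (lev_vol_ge hcont hu2 _ ((hs0 i).trans_lt h)) (lev_vol_lt hcont hu2 _)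
      simp only [hφ]
      rw [← mul_sub]
      exact this
  have hφ00 : φ 0 ≤ C0 ^ (1 / qN N) * a 0 ^ (1 / (N:ℝ)) := by
    have ha0 : 0 ≤ a 0 := hennn _
    have eC : C0 ^ (1 / qN N) = X := by
      rw [hC0, ← Real.rpow_mul hX0.le, mul_one_div_cancel hq0.ne', Real.rpow_one]
    rw [eC]
    rcases (hs0 0).eq_or_lt with h | h
    · simp only [hφ]
      rw [← h, mul_zero]
      positivity
    · have h1 := hMP Ω lam hlam hP u hu (s 0) h
      have h2 : (1:ℝ) ≤ volume.real {y | s 0 ≤ |u y|} := by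
        have h3 := lev_vol_ge hcont hu2 (Real.exp (-((0:ℕ):ℝ))) h
        have hfin : volume {y | s 0 ≤ |u y|} ≠ ⊤ := by
          refine ((measure_mono ?_).trans_lt (vol_level_lt_top hu2)).ne
          intro y hy h0
          have hy' : s 0 ≤ |u y| := hy
          rw [h0, abs_zero] at hy'
          linarith
        rw [ENNReal.ofReal_le_iff_le_toReal hfin] at h3
        rw [Measure.real]
        simpa using h3
      have h4 : s 0 ^ N ≤ M ^ N / lam * a 0 := by
        have h5 : s 0 ^ N ≤ s 0 ^ N * volume.real {y | s 0 ≤ |u y|} :=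
          le_mul_of_one_le_right (by positivity) h2
        have h6 : lam * s 0 ^ N ≤ M ^ N * a 0 :=
          (mul_le_mul_of_nonneg_left h5 hlam.le).trans h1
        rw [div_mul_eq_mul_div, le_div_iff₀ hlam]
        linarith
      have h7 : s 0 ≤ (M ^ N / lam * a 0) ^ (1 / (N:ℝ)) := by
        calc s 0 = (s 0 ^ N) ^ (1 / (N:ℝ)) := by
              rw [one_div, Real.pow_rpow_inv_natCast h.le hN0]
          _ ≤ _ := Real.rpow_le_rpow (by positivity) h4 (by positivity)
      rw [Real.mul_rpow (by positivity) ha0] at h7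
      simp only [hφ]
      rw [hX, mul_assoc]
      gcongr
  have hup : ∀ k : ℕ, φ k ≤ ((k:ℝ) + C) ^ (1 / qN N) * a k ^ (1 / (N:ℝ)) := by
    intro k
    rcases Nat.eq_zero_or_pos k with h | h
    · subst h
      refine hφ00.trans ?_
      have ha0 : 0 ≤ a 0 := hennn _
      gcongr
      push_cast
      linarith
    · have h1 := hlev 0 k h
      have h2 := holder_two hN hC00.le (show (0:ℝ) ≤ ((k:ℝ) - (0:ℕ) + cN N) by
        have : (0:ℝ) ≤ k := by positivity
        push_cast; linarith) (show 0 ≤ a 0 from hennn _)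
        (hennn {y | s 0 < |u y| ∧ |u y| < s k})
      have h3 : φ k ≤ (C0 + ((k:ℝ) - (0:ℕ) + cN N)) ^ (1 / qN N) *
          (a 0 + en u {y | s 0 < |u y| ∧ |u y| < s k}) ^ (1 / (N:ℝ)) := by linarith
      refine h3.trans ?_
      have e : C0 + ((k:ℝ) - (0:ℕ) + cN N) = (k:ℝ) + C := by rw [hC]; push_cast; ring
      rw [e]
      have := hdis2 0 k h.le
      have h5 := hennn {y | s 0 < |u y| ∧ |u y| < s k}
      have h6 : 0 ≤ a 0 := hennn _
      gcongr
  have hD' := hD φ a hφ0 (fun k => hennn _) (fun k => hen1 _) hup (by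
    intro i j hij
    have h1 := hlev i j hij
    have h2 := hdis1 i j
    have h5 := hennn {y | s i < |u y| ∧ |u y| < s j}
    have hij' : (i:ℝ) ≤ j := by exact_mod_cast hij.le
    have h6 : 0 ≤ 1 - a i := by linarith
    have h7 : ((j:ℝ) - i + cN N) ^ (1 / qN N) * en u {y | s i < |u y| ∧ |u y| < s j} ^ (1 / (N:ℝ))
      ≤ ((j:ℝ) - i + C) ^ (1 / qN N) * (1 - a i) ^ (1 / (N:ℝ)) := by
      have : 0 ≤ (j:ℝ) - i + cN N := by linarith
      have : 0 ≤ (j:ℝ) - i + C := by linarith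
      have : cN N ≤ C := by linarith
      gcongr
    linarith)
  constructor
  · have h1 := hup 0
    have h2 : φ 0 ≤ C ^ (1 / qN N) := by
      refine h1.trans ?_
      have h3 : a 0 ^ (1 / (N:ℝ)) ≤ 1 :=
        Real.rpow_le_one (hennn _) (hen1 _) (by positivity)
      have e : ((0:ℕ):ℝ) + C = C := by push_cast; ring
      rw [e]
      exact mul_le_of_le_one_right (by positivity) h3
    have h3 := Real.rpow_le_rpow (hφ0 0) h2 hq0.le
    rw [← Real.rpow_mul hCpos.le, one_div_mul_cancel hq0.ne', Real.rpow_one, hφq] at h3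
    exact h3
  · intro m
    have := hD' m
    simp only [hφq] at this
    exact this

lemma backward (hN : 2 ≤ N) (Ω : Set (EuclideanSpace ℝ (Fin N))) {lam : ℝ} (hlam : 0 < lam)
    (hP : ∀ u : EuclideanSpace ℝ (Fin N) → ℝ, IsTest Ω u →
        lam * ∫ x in Ω, |u x| ^ N ≤ ∫ x in Ω, ‖fderiv ℝ u x‖ ^ N) :
    BddAbove {r : ℝ | ∃ u : EuclideanSpace ℝ (Fin N) → ℝ, IsTest Ω u ∧
        (∫ x in Ω, ‖fderiv ℝ u x‖ ^ N) ≤ 1 ∧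
        r = ∫ x in Ω, PhiMT N (u x)} := by
  have hα := alpha_pos hN
  have hq := qN_gt hN
  have hN0 : N ≠ 0 := by omega
  obtain ⟨C, D, hCD⟩ := exp_level_bound hN Ω hlam hP
  set C2 : ℝ := alphaMT N ^ (N - 1) * Real.exp C with hC2
  have hC20 : 0 < C2 := by positivity
  refine ⟨C2 / lam + Real.exp 1 * |D|, ?_⟩
  rintro r ⟨u, hu, hg, rfl⟩
  obtain ⟨hC, hD⟩ := hCD u hu hg
  have hPu := hP u hu
  obtain ⟨hu1, hu2, hu3⟩ := hu
  have hcont := hu1.continuous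
  have hmabs : Measurable fun y => |u y| := hcont.measurable.norm
  rw [setInt_eq' hu3 (PhiMT N) (Phi_zero hN)]
  have hgN : (fun s : ℝ => |s| ^ N) 0 = 0 := by simp [hN0]
  have e1 : ∫ x in Ω, |u x| ^ N = ∫ x, |u x| ^ N := setInt_eq' hu3 (fun s => |s| ^ N) hgN
  have hi : Integrable fun x => |u x| ^ N :=
    integrable_comp hcont hu2 (fun s => |s| ^ N) (continuous_abs.pow N) hgN
  rw [e1] at hPu
  have hIu : ∫ x, |u x| ^ N ≤ 1 / lam := by
    rw [le_div_iff₀ hlam]; linarith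
  set s : ℕ → ℝ := fun k => lev u (Real.exp (-(k:ℝ))) with hs
  have hs0 : ∀ k, 0 ≤ s k := fun k => lev_nonneg _
  have hvol : ∀ k : ℕ, volume {y | s k < |u y|} ≤ ENNReal.ofReal (Real.exp (-(k:ℝ))) :=
    fun k => lev_vol_lt hcont hu2 _
  have hnull : volume (⋂ k : ℕ, {y | s k < |u y|}) = 0 := by
    refine le_antisymm ?_ bot_le
    have ht : Filter.Tendsto (fun k : ℕ => ENNReal.ofReal (Real.exp (-(k:ℝ)))) Filter.atTop
        (nhds 0) := by
      rw [← ENNReal.ofReal_zero]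
      exact ENNReal.tendsto_ofReal (Real.tendsto_exp_neg_atTop_nhds_zero.comp
        tendsto_natCast_atTop_atTop)
    exact ge_of_tendsto' ht fun k => (measure_mono (iInter_subset _ k)).trans (hvol k)
  have hbound : ∀ᵐ y, ENNReal.ofReal (PhiMT N (u y)) ≤ ENNReal.ofReal (C2 * |u y| ^ N) +
      ∑' k : ℕ, ({y | s k < |u y|}).indicator
        (fun _ => ENNReal.ofReal (Real.exp (alphaMT N * s (k + 1) ^ qN N))) y := by
    have : ∀ᵐ y, y ∉ ⋂ k : ℕ, {y | s k < |u y|} := measure_eq_zero_iff_ae_notMem.1 hnull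
    filter_upwards [this] with y hy
    have hex : ∃ k, |u y| ≤ s k := by
      by_contra hcon
      push Not at hcon
      exact hy (mem_iInter.2 fun k => hcon k)
    classical
    obtain hk0 | ⟨k, hk⟩ : Nat.find hex = 0 ∨ ∃ k, Nat.find hex = k + 1 := by
      rcases h : Nat.find hex with _ | k
      · exact Or.inl rfl
      · exact Or.inr ⟨k, rfl⟩
    · have h1 : |u y| ≤ s 0 := by have := Nat.find_spec hex; rwa [hk0] at this
      refine le_trans (ENNReal.ofReal_le_ofReal ?_) le_self_add
      refine (Phi_upper hN (u y)).trans ?_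
      rw [hC2]
      have h2 : alphaMT N * |u y| ^ qN N ≤ C := by
        refine le_trans ?_ hC
        have : |u y| ^ qN N ≤ s 0 ^ qN N := Real.rpow_le_rpow (abs_nonneg _) h1 (by linarith)
        exact mul_le_mul_of_nonneg_left this hα.le
      gcongr
    · have h1 : |u y| ≤ s (k + 1) := by have := Nat.find_spec hex; rwa [hk] at this
      have h2 : s k < |u y| := not_le.1 (Nat.find_min hex (by omega))
      refine le_trans ?_ le_add_self
      refine le_trans ?_ (ENNReal.le_tsum k)
      rw [indicator_of_mem (show y ∈ {y | s k < |u y|} from h2)]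
      refine ENNReal.ofReal_le_ofReal ((Phi_le_exp hN _).trans (Real.exp_le_exp.2 ?_))
      have : |u y| ^ qN N ≤ s (k+1) ^ qN N := Real.rpow_le_rpow (abs_nonneg _) h1 (by linarith)
      exact mul_le_mul_of_nonneg_left this hα.le
  have hterm : ∀ k : ℕ, ENNReal.ofReal (Real.exp (alphaMT N * s (k + 1) ^ qN N)) *
      volume {y | s k < |u y|} ≤
      ENNReal.ofReal (Real.exp 1 * Real.exp (alphaMT N * s (k + 1) ^ qN N - ((k+1 : ℕ):ℝ))) := by
    intro k
    refine (mul_le_mul_right (hvol k) _).trans_eq ?_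
    rw [← ENNReal.ofReal_mul (Real.exp_pos _).le, ← Real.exp_add, ← Real.exp_add]
    congr 2
    push_cast; ring
  have hsum : ∑' k : ℕ, ENNReal.ofReal (Real.exp (alphaMT N * s (k + 1) ^ qN N)) *
      volume {y | s k < |u y|} ≤ ENNReal.ofReal (Real.exp 1 * |D|) := by
    refine ENNReal.tsum_le_of_sum_range_le fun n => ?_
    refine (Finset.sum_le_sum fun k _ => hterm k).trans ?_
    rw [← ENNReal.ofReal_sum_of_nonneg (fun k _ => by positivity), ← Finset.mul_sum]
    refine ENNReal.ofReal_le_ofReal (mul_le_mul_of_nonneg_left ?_ (Real.exp_pos _).le)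
    have h := hD (n + 1)
    rw [Finset.sum_range_succ'] at h
    have h0 := Real.exp_pos (alphaMT N * lev u (Real.exp (-((0:ℕ):ℝ))) ^ qN N - ((0:ℕ):ℝ))
    refine le_trans ?_ (le_abs_self D)
    refine le_trans ?_ h
    exact le_add_of_nonneg_right h0.le
  have hD1 : 0 ≤ Real.exp 1 * |D| := by positivity
  have hD2 : 0 ≤ C2 / lam := by positivity
  rw [integral_eq_lintegral_of_nonneg_ae (.of_forall fun y => Phi_nonneg hN _)
    ((Phi_continuous hN).comp hcont).aestronglyMeasurable]
  refine ENNReal.toReal_le_of_le_ofReal (by positivity) ?_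
  rw [ENNReal.ofReal_add hD2 hD1]
  refine (lintegral_mono_ae hbound).trans ?_
  rw [lintegral_add_left (by fun_prop)]
  gcongr
  · rw [← ofReal_integral_eq_lintegral_ofReal (hi.const_mul _) (.of_forall fun y => by positivity),
      integral_const_mul]
    apply ENNReal.ofReal_le_ofReal
    rw [div_eq_mul_one_div]
    gcongr
  · have hms : ∀ k, MeasurableSet {y | s k < |u y|} :=
      fun k => measurableSet_lt measurable_const hmabs
    rw [lintegral_tsum (fun k => (measurable_const.indicator (hms k)).aemeasurable)]
    refine le_trans (le_of_eq ?_) hsum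
    congr 1
    ext k
    rw [lintegral_indicator_const (hms k)]

end MTP

end MTPaux

/-- The Moser–Trudinger inequality holds on an open set `Ω ⊆ ℝ^N` (i.e. the supremum of
`∫_Ω Φ(u)` over test functions with `∫_Ω |∇u|^N ≤ 1` is finite) if and only if the Poincaré
inequality holds on `Ω` (i.e. `λ₁(Ω) > 0`, equivalently there is `λ > 0` with
`λ ∫_Ω |u|^N ≤ ∫_Ω |∇u|^N` for all test functions `u`). -/
theorem moser_trudinger_iff_poincare (N : ℕ) (hN : 2 ≤ N)
    (Ω : Set (EuclideanSpace ℝ (Fin N))) (hΩ : IsOpen Ω) :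
    BddAbove {r : ℝ | ∃ u : EuclideanSpace ℝ (Fin N) → ℝ, IsTest Ω u ∧
        (∫ x in Ω, ‖fderiv ℝ u x‖ ^ N) ≤ 1 ∧
        r = ∫ x in Ω, PhiMT N (u x)} ↔
      ∃ lam : ℝ, 0 < lam ∧ ∀ u : EuclideanSpace ℝ (Fin N) → ℝ, IsTest Ω u →
        lam * ∫ x in Ω, |u x| ^ N ≤ ∫ x in Ω, ‖fderiv ℝ u x‖ ^ N := by
  exact ⟨MTP.forward hN Ω, fun ⟨_, hlam, hP⟩ => MTP.backward hN Ω hlam hP⟩
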